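/- arXiv:2312.08784 — 2 statements merged into one kernel-verified Lean document; each statement's English description precedes it below -/
import Mathlib

section
/- Let α ∈ (1/2,1), σ > 0, φ(t) = ασ(1+σt)^{-(α+1)}, and for each n ≥ 1 let ζ_n ∈ (0,1), R_n(t) = ∑_{k=1}^∞ ζ_n^k φ^{*k}(t), and μ_n ≥ 0. Assume n^α(1−ζ_n) → b > 0 and μ_n/n^{α−1} → a ≥ 0 as n → ∞, set γ = b σ^α / Γ(1−α) and I^{(n)}(t) = n^{1−2α} μ_n ( 1 + ∫_0^{nt} R_n(s) ds ). Then sup_{t ≥ 0} | I^{(n)}(t) − (a/b) F^{α,γ}(t) | → 0 as n → ∞. -/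
open MeasureTheory Real Filter Set

/-- Convolution of two functions on `[0,∞)`: `(f * g)(t) = ∫_0^t f(t-s) g(s) ds`. -/
noncomputable def conv (f g : ℝ → ℝ) : ℝ → ℝ := fun t => ∫ s in (0:ℝ)..t, f (t - s) * g s

/-- Convolution powers: `convPow f k = f^{*(k+1)}`, i.e. `convPow f 0 = f`. -/
noncomputable def convPow (f : ℝ → ℝ) : ℕ → ℝ → ℝ
  | 0 => f
  | (k + 1) => conv f (convPow f k)

/-- The Mittag-Leffler function `E_{a,k}(x) = ∑_{m=0}^∞ x^m / Γ(a m + k)`. -/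
noncomputable def mittagLeffler (a k x : ℝ) : ℝ := ∑' m : ℕ, x ^ m / Real.Gamma (a * m + k)

/-- The Mittag-Leffler distribution function `F^{a,g}(t) = 1 - E_{a,1}(-g t^a)`. -/
noncomputable def mlCDF (a g t : ℝ) : ℝ := 1 - mittagLeffler a 1 (-g * t ^ a)


theorem conv_comm' (f g : ℝ → ℝ) (t : ℝ) : conv f g t = conv g f t := by
  unfold conv
  have := intervalIntegral.integral_comp_sub_left (a := 0) (b := t) (fun s => f (t - s) * g s) t
  simp only [sub_self, sub_zero, sub_sub_cancel] at this
  rw [← this]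
  exact intervalIntegral.integral_congr (fun s _ => mul_comm _ _)

theorem conv_congr {f g f' g' : ℝ → ℝ} {t : ℝ} (ht : 0 ≤ t)
    (hf : ∀ s, 0 ≤ s → f s = f' s) (hg : ∀ s, 0 ≤ s → g s = g' s) :
    conv f g t = conv f' g' t := by
  unfold conv
  apply intervalIntegral.integral_congr
  intro s hs
  rw [uIcc_of_le ht] at hs
  simp only
  rw [hf _ (by linarith [hs.2]), hg _ hs.1]

theorem conv_eq_ind (f g : ℝ → ℝ) {t T : ℝ} (ht : 0 ≤ t) (hT : t ≤ T) :
    conv f g t = ∫ s, (Ioo 0 T).indicator f (t - s) * (Ioo 0 T).indicator g s := by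
  unfold conv
  rw [intervalIntegral.integral_of_le ht, integral_Ioc_eq_integral_Ioo,
    ← integral_indicator measurableSet_Ioo]
  congr 1
  ext s
  by_cases h : s ∈ Ioo 0 t
  · have h1 : s ∈ Ioo 0 T := ⟨h.1, h.2.trans_le hT⟩
    have h2 : t - s ∈ Ioo 0 T := ⟨by linarith [h.2], by linarith [h.1]⟩
    simp [h, h1, h2]
  · rw [indicator_of_notMem h]
    by_cases h1 : s ∈ Ioo 0 T
    · have h2 : t - s ∉ Ioo 0 T := fun h2 => h ⟨h1.1, by linarith [h2.1]⟩
      simp [h2]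
    · simp [h1]

theorem conv_assoc_aux {f g h : ℝ → ℝ} {t : ℝ} (ht : 0 ≤ t)
    (hf : IntervalIntegrable f volume 0 t) (hg : IntervalIntegrable g volume 0 t)
    (hh : Continuous h) :
    conv f (conv g h) t = conv (conv f g) h t ∧
      IntervalIntegrable (fun s => f (t - s) * conv g h s) volume 0 t := by
  rw [conv_eq_ind f _ ht le_rfl, conv_eq_ind _ h ht le_rfl]
  set F := (Ioo 0 t).indicator f with hF
  set G := (Ioo 0 t).indicator g with hG
  set H := (Ioo 0 t).indicator h with hH
  have hFi : Integrable F := by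
    rw [hF, integrable_indicator_iff measurableSet_Ioo]
    exact ((intervalIntegrable_iff_integrableOn_Ioo_of_le ht).1 hf)
  have hGi : Integrable G := by
    rw [hG, integrable_indicator_iff measurableSet_Ioo]
    exact ((intervalIntegrable_iff_integrableOn_Ioo_of_le ht).1 hg)
  have e1 : ∀ s, F (t - s) * (Ioo 0 t).indicator (conv g h) s
      = ∫ r, F (t - s) * G (s - r) * H r := by
    intro s
    simp_rw [mul_assoc]
    rw [integral_const_mul]
    by_cases hs : s ∈ Ioo 0 t
    · rw [indicator_of_mem hs, conv_eq_ind g h hs.1.le hs.2.le]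
    · have : F (t - s) = 0 := by
        apply indicator_of_notMem
        intro h2
        exact hs ⟨by linarith [h2.2], by linarith [h2.1]⟩
      rw [this]; simp
  have e2 : ∀ r, (Ioo 0 t).indicator (conv f g) (t - r) * H r
      = ∫ s, F (t - s) * G (s - r) * H r := by
    intro r
    rw [integral_mul_const]
    by_cases hr : r ∈ Ioo 0 t
    · have hr2 : t - r ∈ Ioo 0 t := ⟨by linarith [hr.2], by linarith [hr.1]⟩
      rw [indicator_of_mem hr2, conv_eq_ind f g hr2.1.le hr2.2.le]
      congr 1
      rw [← integral_sub_right_eq_self _ r]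
      congr 1; ext s
      rw [show t - r - (s - r) = t - s by ring]
    · have : H r = 0 := indicator_of_notMem hr _
      rw [this]; simp
  have hFr : Integrable (fun s => F (t - s)) := hFi.comp_sub_left t
  have hGr : Integrable (fun s => G (-s)) := hGi.comp_neg
  have key := (hFr.convolution_integrand (ContinuousLinearMap.mul ℝ ℝ) hGr).swap
  have key2 : Integrable (fun p : ℝ × ℝ => F (t - p.1) * G (p.1 - p.2)) (volume.prod volume) := by
    refine key.congr (Eventually.of_forall fun p => ?_)
    simp
  obtain ⟨M, hM⟩ := (isCompact_Icc (a := (0:ℝ)) (b := t)).exists_bound_of_continuousOn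
    hh.continuousOn
  have hHm : Measurable H := hh.measurable.indicator measurableSet_Ioo
  have key3 : Integrable (fun p : ℝ × ℝ => F (t - p.1) * G (p.1 - p.2) * H p.2)
      (volume.prod volume) := by
    refine key2.mul_bdd (c := max M 0) ?_ ?_
    · exact (hHm.comp measurable_snd).aestronglyMeasurable
    · refine Eventually.of_forall fun p => ?_
      by_cases hr : p.2 ∈ Ioo 0 t
      · rw [hH, indicator_of_mem hr]
        exact (hM _ (Ioo_subset_Icc_self hr)).trans (le_max_left _ _)
      · rw [hH, indicator_of_notMem hr]; simp
  constructor
  · simp_rw [e1, e2]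
    exact integral_integral_swap key3
  · have h3 := key3.integral_prod_left
    rw [intervalIntegrable_iff_integrableOn_Ioo_of_le ht]
    refine (h3.integrableOn (s := Ioo 0 t)).congr_fun (fun s hs => ?_) measurableSet_Ioo
    have h4 : t - s ∈ Ioo 0 t := ⟨by linarith [hs.2], by linarith [hs.1]⟩
    have h5 := e1 s
    rw [indicator_of_mem hs, hF, indicator_of_mem h4] at h5
    rw [h5]
    simp only [hF, indicator_of_mem h4]

theorem conv_assoc' {f g h : ℝ → ℝ} {t : ℝ} (ht : 0 ≤ t)
    (hf : IntervalIntegrable f volume 0 t) (hg : IntervalIntegrable g volume 0 t)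
    (hh : Continuous h) :
    conv f (conv g h) t = conv (conv f g) h t := (conv_assoc_aux ht hf hg hh).1

theorem conv_beta {β p t : ℝ} (hβ : 0 < β) (hp : 0 < p) (ht : 0 < t) :
    conv (fun u => u ^ (β - 1)) (fun u => u ^ (p - 1)) t
      = Real.Gamma β * Real.Gamma p / Real.Gamma (β + p) * t ^ (β + p - 1) := by
  have h1 := Complex.betaIntegral_scaled (p : ℂ) (β : ℂ) ht
  rw [Complex.betaIntegral_eq_Gamma_mul_div _ _ (by simpa using hp) (by simpa using hβ)] at h1
  apply Complex.ofReal_injective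
  unfold conv
  rw [← intervalIntegral.integral_ofReal]
  have h2 : ∫ s in (0:ℝ)..t, (((t - s) ^ (β - 1) * s ^ (p - 1) : ℝ) : ℂ)
      = ∫ x in (0:ℝ)..t, (x:ℂ) ^ ((p:ℂ) - 1) * ((t:ℂ) - x) ^ ((β:ℂ) - 1) := by
    apply intervalIntegral.integral_congr
    intro s hs
    rw [uIcc_of_le ht.le] at hs
    simp only
    rw [Complex.ofReal_mul, Complex.ofReal_cpow (by linarith [hs.2]), Complex.ofReal_cpow hs.1]
    push_cast
    ring
  rw [h2, h1]
  rw [← Complex.ofReal_add, Complex.Gamma_ofReal, Complex.Gamma_ofReal, Complex.Gamma_ofReal]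
  push_cast
  rw [Complex.ofReal_cpow ht.le]
  push_cast
  rw [add_comm (p:ℂ) β, add_comm p β]
  ring

theorem conv_mono {k f g : ℝ → ℝ} {t : ℝ} (ht : 0 ≤ t)
    (hk : IntervalIntegrable k volume 0 t) (hk0 : ∀ s, 0 ≤ s → 0 ≤ k s)
    (hf : Continuous f) (hg : Continuous g) (hfg : ∀ s ∈ Icc 0 t, f s ≤ g s) :
    conv k f t ≤ conv k g t := by
  unfold conv
  have hk' : IntervalIntegrable (fun s => k (t - s)) volume 0 t := by
    simpa using (hk.comp_sub_left t).symm
  apply intervalIntegral.integral_mono_on ht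
  · exact hk'.mul_continuousOn hf.continuousOn
  · exact hk'.mul_continuousOn hg.continuousOn
  · intro s hs
    exact mul_le_mul_of_nonneg_left (hfg s hs) (hk0 _ (by linarith [hs.2]))

theorem conv_int {k f : ℝ → ℝ} {t : ℝ}
    (hk : IntervalIntegrable k volume 0 t) (hf : Continuous f) :
    IntervalIntegrable (fun s => k (t - s) * f s) volume 0 t := by
  have hk' : IntervalIntegrable (fun s => k (t - s)) volume 0 t := by
    simpa using (hk.comp_sub_left t).symm
  exact hk'.mul_continuousOn hf.continuousOn

theorem continuous_conv {f g : ℝ → ℝ} (hf : Continuous f) (hg : Continuous g) :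
    Continuous (conv f g) := by
  unfold conv
  exact intervalIntegral.continuous_parametric_intervalIntegral_of_continuous
    (f := fun t s => f (t - s) * g s) (by fun_prop) continuous_id


theorem gamma_lower {x N : ℝ} (hx : 0 ≤ x) (hN : 0 < N) :
    N ^ x * Real.exp (-(N + 1)) ≤ Real.Gamma (x + 1) := by
  rw [Real.Gamma_eq_integral (by linarith)]
  have hi := Real.GammaIntegral_convergent (s := x + 1) (by linarith)
  have hsub : Ioc N (N + 1) ⊆ Ioi 0 := fun y hy => hN.trans hy.1
  have h1 : ∫ y in Ioc N (N + 1), N ^ x * Real.exp (-(N + 1)) ∂volume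
      ≤ ∫ y in Ioc N (N + 1), Real.exp (-y) * y ^ (x + 1 - 1) := by
    apply setIntegral_mono_on
    · exact integrableOn_const (by simp)
    · exact hi.mono_set hsub
    · exact measurableSet_Ioc
    · intro y hy
      rw [add_sub_cancel_right, mul_comm]
      have : N ^ x ≤ y ^ x := Real.rpow_le_rpow hN.le hy.1.le hx
      have h2 : Real.exp (-(N + 1)) ≤ Real.exp (-y) := Real.exp_le_exp.2 (by linarith [hy.2])
      have := Real.rpow_nonneg hN.le x
      gcongr
  have h2 : ∫ y in Ioc N (N + 1), N ^ x * Real.exp (-(N + 1)) ∂volume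
      = N ^ x * Real.exp (-(N + 1)) := by
    rw [setIntegral_const]; simp
  rw [← h2]
  refine h1.trans (setIntegral_mono_set hi ?_ (LE.le.eventuallyLE hsub))
  filter_upwards [ae_restrict_mem measurableSet_Ioi] with y hy
  exact mul_nonneg (Real.exp_pos _).le (Real.rpow_nonneg (le_of_lt hy) _)

noncomputable def mlS (α c p t : ℝ) : ℝ :=
  ∑' m : ℕ, c ^ m * t ^ (α * m + p) / Real.Gamma (α * m + p + 1)

theorem mlS_summable {α c p t : ℝ} (hα : 0 < α) (hp : 0 ≤ p) (ht : 0 ≤ t) :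
    Summable (fun m : ℕ => |c| ^ m * t ^ (α * m + p) / Real.Gamma (α * m + p + 1)) := by
  rcases ht.eq_or_lt with rfl | ht
  · apply summable_of_ne_finset_zero (s := {0})
    intro m hm
    have hm' : m ≠ 0 := by simpa using hm
    have hm0 : (0:ℝ) < m := by exact_mod_cast Nat.pos_of_ne_zero hm'
    have : α * m + p ≠ 0 := by positivity
    rw [Real.zero_rpow this]; simp
  set A := |c| * t ^ α with hA
  have hA0 : 0 ≤ A := by positivity
  set N := (2 * (A + 1)) ^ (1 / α) with hN
  have hN0 : 0 < N := by positivity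
  have hNα : N ^ α = 2 * (A + 1) := by
    rw [hN, ← Real.rpow_mul (by positivity), one_div, inv_mul_cancel₀ hα.ne', Real.rpow_one]
  have hg : Summable (fun m : ℕ => (t ^ p / N ^ p * Real.exp (N + 1)) * (1 / 2 : ℝ) ^ m) :=
    (summable_geometric_of_lt_one (by norm_num) (by norm_num)).mul_left _
  refine Summable.of_nonneg_of_le (fun m => ?_) (fun m => ?_) hg
  · have := Real.Gamma_pos_of_pos (s := α * m + p + 1) (by positivity)
    positivity
  · have h1 := gamma_lower (x := α * m + p) (N := N) (by positivity) hN0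
    have hpos : 0 < N ^ (α * m + p) * Real.exp (-(N + 1)) := by positivity
    have h2 : |c| ^ m * t ^ (α * m + p) = A ^ m * t ^ p := by
      rw [Real.rpow_add ht, Real.rpow_mul ht.le, Real.rpow_natCast, hA, mul_pow]; ring
    have h3 : N ^ (α * m + p) = (2 * (A + 1)) ^ m * N ^ p := by
      rw [Real.rpow_add hN0, Real.rpow_mul hN0.le, Real.rpow_natCast, hNα]
    calc _ ≤ |c| ^ m * t ^ (α * m + p) / (N ^ (α * m + p) * Real.exp (-(N + 1))) := by
          gcongr
      _ = (t ^ p / N ^ p * Real.exp (N + 1)) * (A / (2 * (A + 1))) ^ m := by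
          rw [h2, h3, Real.exp_neg, div_pow]
          field_simp
      _ ≤ _ := by
          have hq : A / (2 * (A + 1)) ≤ 1 / 2 := by
            rw [div_le_div_iff₀ (by positivity) (by norm_num)]
            linarith
          exact mul_le_mul_of_nonneg_left (pow_le_pow_left₀ (by positivity) hq m) (by positivity)

theorem mlS_term_bound {α c p s t : ℝ} (hα : 0 < α) (hp : 0 ≤ p) (hs : 0 ≤ s) (hst : s ≤ t)
    (m : ℕ) : ‖c ^ m * s ^ (α * m + p) / Real.Gamma (α * m + p + 1)‖ ≤
      |c| ^ m * t ^ (α * m + p) / Real.Gamma (α * m + p + 1) := by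
  have hG := Real.Gamma_pos_of_pos (s := α * m + p + 1) (by positivity)
  have : 0 ≤ s ^ (α * m + p) := by positivity
  rw [Real.norm_eq_abs, abs_div, abs_mul, abs_pow, abs_of_pos hG, abs_of_nonneg this]
  gcongr

theorem mlS_hasSum {α c p t : ℝ} (hα : 0 < α) (hp : 0 ≤ p) (ht : 0 ≤ t) :
    HasSum (fun m : ℕ => c ^ m * t ^ (α * m + p) / Real.Gamma (α * m + p + 1)) (mlS α c p t) :=
  (Summable.of_norm_bounded (mlS_summable hα hp ht)
    (fun m => mlS_term_bound hα hp ht le_rfl m)).hasSum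

theorem mlS_continuous {α c p : ℝ} (hα : 0 < α) (hp : 0 ≤ p) :
    Continuous (fun t => mlS α c p (max t 0)) := by
  rw [continuous_iff_continuousAt]
  intro x
  have : ContinuousOn (fun t => mlS α c p (max t 0)) (Iio (x + 1)) := by
    unfold mlS
    refine continuousOn_tsum (u := fun m : ℕ => |c| ^ m * (max (x + 1) 0) ^ (α * m + p)
      / Real.Gamma (α * m + p + 1)) ?_ (mlS_summable hα hp (le_max_right _ _)) ?_
    · intro m
      have h0 : 0 ≤ α * m + p := by positivity
      have := (Real.continuous_rpow_const h0).comp (continuous_id.max (continuous_const (y := (0:ℝ))))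
      exact ((continuous_const.mul this).div_const _).continuousOn
    · intro m s hs
      exact mlS_term_bound hα hp (le_max_right _ _) (max_le_max_right _ (le_of_lt hs)) m
  exact this.continuousAt (Iio_mem_nhds (by linarith))

theorem conv_mlS {α c p β t : ℝ} (hα : 0 < α) (hp : 0 ≤ p) (hβ : 0 < β) (ht : 0 ≤ t) :
    conv (fun u => u ^ (β - 1)) (mlS α c p) t = Real.Gamma β * mlS α c (p + β) t := by
  rcases ht.eq_or_lt with rfl | ht
  · unfold conv mlS
    rw [intervalIntegral.integral_same]
    have : ∀ m : ℕ, c ^ m * (0:ℝ) ^ (α * m + (p + β)) / Real.Gamma (α * m + (p + β) + 1) = 0 := by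
      intro m
      rw [Real.zero_rpow (by positivity)]; simp
    simp_rw [this]; simp
  have hk : IntervalIntegrable (fun u : ℝ => u ^ (β - 1)) volume 0 t :=
    intervalIntegral.intervalIntegrable_rpow' (by linarith)
  have hk' : IntervalIntegrable (fun s : ℝ => (t - s) ^ (β - 1)) volume 0 t := by
    simpa using (hk.comp_sub_left t).symm
  have key := intervalIntegral.hasSum_integral_of_dominated_convergence (μ := volume)
    (a := 0) (b := t)
    (F := fun (m : ℕ) s => (t - s) ^ (β - 1) *
      (c ^ m * s ^ (α * m + p) / Real.Gamma (α * m + p + 1)))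
    (f := fun s => (t - s) ^ (β - 1) * mlS α c p s)
    (fun m s => (t - s) ^ (β - 1) * (|c| ^ m * t ^ (α * m + p) / Real.Gamma (α * m + p + 1)))
    ?_ ?_ ?_ ?_ ?_
  · have h2 := (mlS_hasSum (c := c) hα (add_nonneg hp hβ.le) ht.le).mul_left (Real.Gamma β)
    refine HasSum.unique key ?_
    refine Eq.mpr (congrArg (fun w : ℕ → ℝ => HasSum w (Real.Gamma β * mlS α c (p + β) t))
      (funext fun m : ℕ => ?_)) h2
    have hb := conv_beta (β := β) (p := α * m + p + 1) hβ (by positivity) ht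
    unfold conv at hb
    have hG := (Real.Gamma_pos_of_pos (s := α * m + p + 1) (by positivity)).ne'
    rw [add_sub_cancel_right] at hb
    calc _ = ∫ s in (0:ℝ)..t, (c ^ m / Real.Gamma (α * m + p + 1)) *
            ((t - s) ^ (β - 1) * s ^ (α * m + p)) := by
          congr 1; ext s; ring
      _ = _ := by
          rw [intervalIntegral.integral_const_mul, hb]
          rw [show β + (α * m + p + 1) = α * m + (p + β) + 1 by ring, add_sub_cancel_right]
          field_simp
  · intro m
    refine (((continuous_const.sub continuous_id).measurable.pow_const _).mul ?_).aestronglyMeasurable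
    exact (measurable_const.mul (measurable_id.pow_const _)).div_const _
  · intro m
    refine Eventually.of_forall fun s hs => ?_
    rw [uIoc_of_le ht.le] at hs
    rw [norm_mul, Real.norm_of_nonneg (Real.rpow_nonneg (by linarith [hs.2]) _)]
    exact mul_le_mul_of_nonneg_left (mlS_term_bound hα hp hs.1.le hs.2 m)
      (Real.rpow_nonneg (by linarith [hs.2]) _)
  · exact Eventually.of_forall fun s hs => (mlS_summable hα hp ht.le).mul_left _
  · simp_rw [tsum_mul_left]
    exact hk'.mul_const _
  · refine Eventually.of_forall fun s hs => ?_
    rw [uIoc_of_le ht.le] at hs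
    exact (mlS_hasSum hα hp hs.1.le).mul_left _


theorem convPow_continuous {ψ : ℝ → ℝ} (hψ : Continuous ψ) (k : ℕ) :
    Continuous (convPow ψ k) := by
  induction k with
  | zero => exact hψ
  | succ k ih => exact continuous_conv hψ ih

theorem convPow_congr {φ ψ : ℝ → ℝ} (h : ∀ t, 0 ≤ t → φ t = ψ t) (k : ℕ) :
    ∀ t, 0 ≤ t → convPow φ k t = convPow ψ k t := by
  induction k with
  | zero => exact h
  | succ k ih => exact fun t ht => conv_congr ht h ih

theorem conv_one_left (f : ℝ → ℝ) (t : ℝ) : conv (fun _ => 1) f t = ∫ s in (0:ℝ)..t, f s := by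
  simp [conv]

theorem conv_one_right (f : ℝ → ℝ) (t : ℝ) : conv f (fun _ => 1) t = ∫ s in (0:ℝ)..t, f s := by
  rw [conv_comm', conv_one_left]

theorem convPow_bounds {ψ : ℝ → ℝ} {M : ℝ} (hψ : Continuous ψ) (h0 : ∀ t, 0 ≤ ψ t)
    (hM : ∀ t, ψ t ≤ M) (h1 : ∀ t, 0 ≤ t → ∫ s in (0:ℝ)..t, ψ s ≤ 1) (k : ℕ) :
    ∀ t, 0 ≤ t → 0 ≤ convPow ψ k t ∧ convPow ψ k t ≤ M := by
  have hM0 : 0 ≤ M := (h0 0).trans (hM 0)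
  induction k with
  | zero => exact fun t _ => ⟨h0 t, hM t⟩
  | succ k ih =>
    intro t ht
    have hi := hψ.intervalIntegrable (μ := volume) 0 t
    have hc := convPow_continuous hψ k
    constructor
    · have := conv_mono (f := fun _ => 0) (g := convPow ψ k) ht hi (fun s _ => h0 s)
        continuous_const hc (fun s hs => (ih s hs.1).1)
      have e : conv ψ (fun _ => 0) t = 0 := by simp [conv]
      rw [e] at this
      exact this
    · have := conv_mono (f := convPow ψ k) (g := fun _ => M) ht hi (fun s _ => h0 s)
        hc continuous_const (fun s hs => (ih s hs.1).2)
      refine this.trans ?_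
      have e : conv ψ (fun _ => M) t = (∫ s in (0:ℝ)..t, ψ s) * M := by
        rw [conv_comm']; simp [conv, mul_comm]
      rw [e]
      have := mul_le_mul_of_nonneg_right (h1 t ht) hM0
      linarith

theorem renewal {ψ : ℝ → ℝ} {M ζ : ℝ} (hψ : Continuous ψ) (h0 : ∀ t, 0 ≤ ψ t)
    (hM : ∀ t, ψ t ≤ M) (h1 : ∀ t, 0 ≤ t → ∫ s in (0:ℝ)..t, ψ s ≤ 1)
    (hζ : ζ ∈ Ioo (0:ℝ) 1) :
    ∃ r : ℝ → ℝ, Continuous r ∧ (∀ t, 0 ≤ r t) ∧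
      (∀ t, 0 ≤ t → r t = ∑' k : ℕ, ζ ^ (k + 1) * convPow ψ k t) ∧
      (∀ t, 0 ≤ t → 1 + ∫ s in (0:ℝ)..t, r s ≤ 1 / (1 - ζ)) ∧
      (∀ t, 0 ≤ t → conv (fun u => 1 - ζ * ∫ s in (0:ℝ)..u, ψ s)
        (fun u => 1 + ∫ s in (0:ℝ)..u, r s) t = t) := by
  obtain ⟨hζ0, hζ1⟩ := hζ
  have hM0 : 0 ≤ M := (h0 0).trans (hM 0)
  have hP := convPow_bounds hψ h0 hM h1
  have hPc := convPow_continuous hψ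
  set r : ℝ → ℝ := fun t => ∑' k : ℕ, ζ ^ (k + 1) * convPow ψ k (max t 0) with hr
  have hgeo : Summable (fun k : ℕ => ζ ^ (k + 1) * M) := by
    have := (summable_geometric_of_lt_one hζ0.le hζ1).mul_right (ζ * M)
    refine this.congr fun k => ?_
    ring
  have hbd : ∀ (k : ℕ) t, ‖ζ ^ (k + 1) * convPow ψ k (max t 0)‖ ≤ ζ ^ (k + 1) * M := by
    intro k t
    obtain ⟨a1, a2⟩ := hP k (max t 0) (le_max_right _ _)
    rw [Real.norm_of_nonneg (by positivity)]
    gcongr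
  have hsum : ∀ t, HasSum (fun k : ℕ => ζ ^ (k + 1) * convPow ψ k (max t 0)) (r t) := fun t =>
    (Summable.of_norm_bounded hgeo (fun k => hbd k t)).hasSum
  have hrc : Continuous r := by
    refine continuous_tsum (fun k => ?_) hgeo hbd
    exact continuous_const.mul ((hPc k).comp (continuous_id.max continuous_const))
  have hr0 : ∀ t, 0 ≤ r t := fun t => tsum_nonneg fun k =>
    mul_nonneg (by positivity) (hP k _ (le_max_right _ _)).1
  have hre : ∀ t, 0 ≤ t → r t = ∑' k : ℕ, ζ ^ (k + 1) * convPow ψ k t := by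
    intro t ht; simp only [hr]; rw [max_eq_left ht]
  -- the renewal equation
  have heq : ∀ t, 0 ≤ t → r t = ζ * ψ t + ζ * conv ψ r t := by
    intro t ht
    have key := intervalIntegral.hasSum_integral_of_dominated_convergence (μ := volume)
      (a := 0) (b := t)
      (F := fun (k : ℕ) s => ψ (t - s) * (ζ ^ (k + 1) * convPow ψ k (max s 0)))
      (f := fun s => ψ (t - s) * r s)
      (fun k _ => M * (ζ ^ (k + 1) * M)) ?_ ?_ ?_ ?_ ?_
    · have key2 : HasSum (fun k : ℕ => ζ ^ (k + 1) * convPow ψ (k + 1) t) (conv ψ r t) := by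
        refine Eq.mpr (congrArg (fun w : ℕ → ℝ => HasSum w (conv ψ r t))
          (funext fun k : ℕ => ?_)) key
        have : (∫ s in (0:ℝ)..t, ψ (t - s) * (ζ ^ (k + 1) * convPow ψ k (max s 0)))
            = ∫ s in (0:ℝ)..t, ζ ^ (k + 1) * (ψ (t - s) * convPow ψ k s) := by
          apply intervalIntegral.integral_congr
          intro s hs
          rw [uIcc_of_le ht] at hs
          simp only
          rw [max_eq_left hs.1]; ring
        rw [this, intervalIntegral.integral_const_mul]
        rfl
      have h3 := hsum t
      rw [max_eq_left ht] at h3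
      rw [hre t ht, h3.summable.tsum_eq_zero_add, ← key2.tsum_eq, ← tsum_mul_left]
      simp only [zero_add, pow_one, convPow]
      congr 2
      ext k; ring
    · intro k
      exact (Continuous.mul (by fun_prop) (continuous_const.mul
        ((hPc k).comp (continuous_id.max continuous_const)))).aestronglyMeasurable
    · intro k
      refine Eventually.of_forall fun s hs => ?_
      rw [norm_mul]
      gcongr
      · rw [Real.norm_of_nonneg (h0 _)]; exact hM _
      · exact hbd k s
    · exact Eventually.of_forall fun s hs => hgeo.mul_left _
    · exact intervalIntegrable_const
    · exact Eventually.of_forall fun s hs => (hsum s).mul_left _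
  set Φ : ℝ → ℝ := fun u => ∫ s in (0:ℝ)..u, ψ s with hΦ
  have hΦ1 : conv (fun _ => 1) ψ = Φ := by ext t; rw [conv_one_left]
  have hone : Continuous (fun _ : ℝ => (1:ℝ)) := continuous_const
  have hΦc : Continuous Φ := by rw [← hΦ1]; exact continuous_conv hone hψ
  set A : ℝ → ℝ := fun u => ∫ s in (0:ℝ)..u, r s with hA
  have hA1 : conv (fun _ => 1) r = A := by ext t; rw [conv_one_left]
  have hAc : Continuous A := by rw [← hA1]; exact continuous_conv hone hrc
  have hAeq : ∀ t, 0 ≤ t → A t = ζ * Φ t + ζ * conv Φ r t := by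
    intro t ht
    have e1 : A t = ∫ s in (0:ℝ)..t, (ζ * ψ s + ζ * conv ψ r s) := by
      apply intervalIntegral.integral_congr
      intro s hs
      rw [uIcc_of_le ht] at hs
      exact heq s hs.1
    have hcc := continuous_conv hψ hrc
    rw [e1, intervalIntegral.integral_add (f := fun s => ζ * ψ s) (g := fun s => ζ * conv ψ r s)
      (Continuous.intervalIntegrable (by fun_prop) _ _)
      (Continuous.intervalIntegrable (by fun_prop) _ _),
      intervalIntegral.integral_const_mul, intervalIntegral.integral_const_mul,
      ← conv_one_left (conv ψ r), conv_assoc' ht (hone.intervalIntegrable _ _)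
      (hψ.intervalIntegrable _ _) hrc, hΦ1]
  have hA0 : ∀ t, 0 ≤ t → 0 ≤ A t := fun t ht =>
    intervalIntegral.integral_nonneg ht fun s _ => hr0 s
  refine ⟨r, hrc, hr0, hre, ?_, ?_⟩
  · intro t ht
    have h2 : conv Φ r t ≤ A t := by
      rw [conv_comm', ← hA1, conv_comm' _ r]
      exact conv_mono ht (hrc.intervalIntegrable _ _) (fun s _ => hr0 s) hΦc hone
        (fun s hs => h1 s hs.1)
    have h3 : Φ t ≤ 1 := h1 t ht
    have h4 := hAeq t ht
    rw [le_div_iff₀ (by linarith)]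
    change (1 + A t) * (1 - ζ) ≤ 1
    nlinarith
  · intro t ht
    set K : ℝ → ℝ := fun u => 1 - ζ * Φ u with hK
    have hKc : Continuous K := continuous_const.sub (continuous_const.mul hΦc)
    have hKr : ∀ s, 0 ≤ s → conv K r s = ζ * Φ s := by
      intro s hs
      have : conv K r s = A s - ζ * conv Φ r s := by
        rw [← hA1]
        unfold conv
        rw [← intervalIntegral.integral_const_mul, ← intervalIntegral.integral_sub]
        · apply intervalIntegral.integral_congr
          intro x _
          simp only [hK]; ring
        · exact Continuous.intervalIntegrable (by fun_prop) _ _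
        · exact Continuous.intervalIntegrable (by fun_prop) _ _
      rw [this, hAeq s hs]; ring
    have hKA : conv K A t = conv (fun _ => 1) (conv K r) t := by
      rw [← hA1, conv_assoc' ht (hKc.intervalIntegrable _ _) (hone.intervalIntegrable _ _) hrc,
        conv_assoc' ht (hone.intervalIntegrable _ _) (hKc.intervalIntegrable _ _) hrc]
      congr 1
      ext s; exact conv_comm' _ _ _
    have hsplit : conv K (fun u => 1 + A u) t = conv K (fun _ => 1) t + conv K A t := by
      unfold conv
      rw [← intervalIntegral.integral_add]
      · congr 1; ext s; ring
      · exact Continuous.intervalIntegrable (by fun_prop) _ _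
      · exact Continuous.intervalIntegrable (by fun_prop) _ _
    change conv K (fun u => 1 + A u) t = t
    rw [hsplit, hKA, conv_one_right, conv_one_left, ← intervalIntegral.integral_add]
    · have : ∫ s in (0:ℝ)..t, (K s + conv K r s) = ∫ s in (0:ℝ)..t, (1:ℝ) := by
        apply intervalIntegral.integral_congr
        intro s hs
        rw [uIcc_of_le ht] at hs
        simp only
        rw [hKr s hs.1]; simp only [hK]; ring
      rw [this]; simp
    · exact hKc.intervalIntegrable _ _
    · exact (continuous_conv hKc hrc).intervalIntegrable _ _


theorem scaled {α σ ζ : ℝ} (hα : 0 < α) (hσ : 0 < σ) (hζ : ζ ∈ Ioo (0:ℝ) 1)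
    {φ : ℝ → ℝ} (hφ : ∀ t : ℝ, φ t = α * σ * (1 + σ * t) ^ (-(α + 1)))
    {n : ℕ} (hn : 1 ≤ n) :
    ∃ G : ℝ → ℝ, Continuous G ∧ Monotone G ∧ G 0 = (n:ℝ) ^ (-α) ∧
      (∀ t, 0 ≤ t → G t ≤ 1 / ((n:ℝ) ^ α * (1 - ζ))) ∧
      (∀ t, 0 ≤ t →
        conv (fun u => (n:ℝ) ^ α * (1 - ζ) + ζ * (1 / n + σ * u) ^ (-α)) G t = t) ∧
      (∀ t, 0 ≤ t → G t = (n:ℝ) ^ (-α) *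
        (1 + ∫ s in (0:ℝ)..(n * t), ∑' k : ℕ, ζ ^ (k + 1) * convPow φ k s)) := by
  have hn0 : (0:ℝ) < n := by exact_mod_cast hn
  set ψ : ℝ → ℝ := fun t => α * σ * (1 + σ * max t 0) ^ (-(α + 1)) with hψ
  have hpos : ∀ t : ℝ, 1 ≤ 1 + σ * max t 0 := fun t => by
    have : 0 ≤ σ * max t 0 := mul_nonneg hσ.le (le_max_right _ _)
    linarith
  have hψc : Continuous ψ := by
    refine continuous_const.mul (Continuous.rpow_const (by fun_prop) fun t => Or.inl ?_)
    linarith [hpos t]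
  have hψ0 : ∀ t, 0 ≤ ψ t := fun t => by
    have := hpos t
    have : 0 ≤ (1 + σ * max t 0) ^ (-(α + 1)) := Real.rpow_nonneg (by linarith) _
    positivity
  have hψM : ∀ t, ψ t ≤ α * σ := fun t => by
    have : (1 + σ * max t 0) ^ (-(α + 1)) ≤ 1 :=
      Real.rpow_le_one_of_one_le_of_nonpos (hpos t) (by linarith)
    have h2 : 0 ≤ α * σ := by positivity
    simp only [hψ]
    nlinarith
  have hintg : ∀ t, 0 ≤ t → ∫ s in (0:ℝ)..t, ψ s = 1 - (1 + σ * t) ^ (-α) := by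
    intro t ht
    have hd : ∀ s ∈ uIcc 0 t, HasDerivAt (fun s => -(1 + σ * s) ^ (-α)) (ψ s) s := by
      intro s hs
      rw [uIcc_of_le ht] at hs
      have h1 : 0 < 1 + σ * s := by have := mul_nonneg hσ.le hs.1; linarith
      have h2 : HasDerivAt (fun s => 1 + σ * s) σ s := by
        simpa using ((hasDerivAt_id s).const_mul σ).const_add 1
      have h3 := (h2.rpow_const (p := -α) (Or.inl h1.ne')).neg
      refine HasDerivAt.congr_deriv (f := fun s => -(1 + σ * s) ^ (-α)) h3 ?_
      simp only [hψ]
      rw [max_eq_left hs.1, show -(α + 1) = -α - 1 by ring]; ring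
    rw [intervalIntegral.integral_eq_sub_of_hasDerivAt hd (hψc.intervalIntegrable _ _)]
    simp; ring
  have h1 : ∀ t, 0 ≤ t → ∫ s in (0:ℝ)..t, ψ s ≤ 1 := by
    intro t ht
    rw [hintg t ht]
    have : 0 ≤ (1 + σ * t) ^ (-α) := Real.rpow_nonneg (by positivity) _
    linarith
  obtain ⟨r, hrc, hr0, hre, hU, hK⟩ := renewal hψc hψ0 hψM h1 hζ
  have hφψ : ∀ t, 0 ≤ t → φ t = ψ t := by
    intro t ht; rw [hφ]; simp only [hψ]; rw [max_eq_left ht]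
  have hAc : Continuous (fun t => ∫ s in (0:ℝ)..t, r s) :=
    intervalIntegral.continuous_primitive (fun a b => hrc.intervalIntegrable a b) 0
  have hAm : Monotone (fun t => ∫ s in (0:ℝ)..t, r s) := by
    intro x y hxy
    have := intervalIntegral.integral_add_adjacent_intervals
      (hrc.intervalIntegrable (μ := volume) 0 x) (hrc.intervalIntegrable x y)
    have h2 : 0 ≤ ∫ s in x..y, r s := intervalIntegral.integral_nonneg hxy fun s _ => hr0 s
    simp only; linarith
  have hnα : 0 < (n:ℝ) ^ (-α) := by positivity
  refine ⟨fun t => (n:ℝ) ^ (-α) * (1 + ∫ s in (0:ℝ)..(n * t), r s), ?_, ?_, ?_, ?_, ?_, ?_⟩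
  · exact continuous_const.mul (continuous_const.add (hAc.comp (by fun_prop)))
  · intro x y hxy
    have := hAm (mul_le_mul_of_nonneg_left hxy hn0.le)
    simp only at this ⊢
    gcongr
  · simp
  · intro t ht
    have := hU (n * t) (by positivity)
    calc _ ≤ (n:ℝ) ^ (-α) * (1 / (1 - ζ)) := mul_le_mul_of_nonneg_left this hnα.le
      _ = _ := by rw [Real.rpow_neg hn0.le]; field_simp
  · intro t ht
    have h2 := hK (n * t) (by positivity)
    unfold conv at h2 ⊢
    have h3 := intervalIntegral.integral_comp_mul_left (a := 0) (b := t)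
      (fun s => (1 - ζ * ∫ x in (0:ℝ)..(n * t - s), ψ x) * (1 + ∫ x in (0:ℝ)..s, r x)) hn0.ne'
    rw [mul_zero, h2, smul_eq_mul, ← mul_assoc, inv_mul_cancel₀ hn0.ne', one_mul] at h3
    refine Eq.trans ?_ h3
    apply intervalIntegral.integral_congr
    intro s hs
    rw [uIcc_of_le ht] at hs
    have hts : 0 ≤ t - s := by linarith [hs.2]
    simp only
    rw [← mul_sub, hintg _ (by positivity)]
    have e : (1 + σ * (n * (t - s))) = n * (1 / n + σ * (t - s)) := by field_simp
    rw [e, Real.mul_rpow hn0.le (by positivity), Real.rpow_neg hn0.le]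
    have : 0 < (n:ℝ) ^ α := by positivity
    field_simp
    ring
  · intro t ht
    simp only
    congr 2
    apply intervalIntegral.integral_congr
    intro s hs
    rw [uIcc_of_le (by positivity)] at hs
    simp only
    rw [hre s hs.1]
    congr 1; ext k
    rw [convPow_congr hφψ k s hs.1]


theorem kint {α t : ℝ} (hα : 0 < α) :
    IntervalIntegrable (fun u : ℝ => u ^ (α - 1)) volume 0 t :=
  intervalIntegral.intervalIntegrable_rpow' (by linarith)

theorem exp_kernel_bound {α l t : ℝ} (hα : 0 < α) (hl : 0 < l) (ht : 0 ≤ t) :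
    IntervalIntegrable (fun u => u ^ (α - 1) * Real.exp (-(l * u))) volume 0 t ∧
    ∫ u in (0:ℝ)..t, u ^ (α - 1) * Real.exp (-(l * u)) ≤ (1 / l) ^ α * Real.Gamma α := by
  have key := Real.integral_rpow_mul_exp_neg_mul_Ioi hα hl
  have hG := Real.Gamma_pos_of_pos hα
  have hi : IntegrableOn (fun u => u ^ (α - 1) * Real.exp (-(l * u))) (Ioi 0) :=
    .of_integral_ne_zero (by rw [key]; positivity)
  have hsub : Ioc 0 t ⊆ Ioi 0 := fun y hy => hy.1
  refine ⟨(intervalIntegrable_iff_integrableOn_Ioc_of_le ht).2 (hi.mono_set hsub), ?_⟩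
  rw [← key, intervalIntegral.integral_of_le ht]
  refine setIntegral_mono_set hi ?_ (LE.le.eventuallyLE hsub)
  filter_upwards [ae_restrict_mem measurableSet_Ioi] with y hy
  exact mul_nonneg (Real.rpow_nonneg (le_of_lt hy) _) (Real.exp_pos _).le

theorem gronwall_frac {α C T : ℝ} (hα : 0 < α) (hC : 0 < C) (hT : 0 ≤ T) :
    ∃ Q : ℝ, 0 < Q ∧ ∀ (d : ℝ → ℝ) (ε : ℝ), Continuous d → 
      (∀ t ∈ Icc 0 T, |d t| ≤ ε + C * conv (fun u => u ^ (α - 1)) (fun s => |d s|) t) →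
      ∀ t ∈ Icc 0 T, |d t| ≤ Q * ε := by
  have hG := Real.Gamma_pos_of_pos hα
  set l := (2 * C * Real.Gamma α) ^ (1 / α) with hl
  have hl0 : 0 < l := by positivity
  have hlα : C * ((1 / l) ^ α * Real.Gamma α) = 1 / 2 := by
    rw [Real.div_rpow zero_le_one hl0.le, hl, ← Real.rpow_mul (by positivity), one_div α,
      inv_mul_cancel₀ hα.ne', Real.rpow_one, Real.one_rpow]
    field_simp
  refine ⟨2 * Real.exp (l * T), by positivity, ?_⟩
  intro d ε hd h
  have hwc : Continuous (fun t => Real.exp (-(l * t)) * |d t|) := by fun_prop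
  obtain ⟨x, hx, hmax⟩ := (isCompact_Icc (a := (0:ℝ)) (b := T)).exists_isMaxOn
    (nonempty_Icc.2 hT) hwc.continuousOn
  set M := Real.exp (-(l * x)) * |d x| with hM
  have hM0 : 0 ≤ M := by positivity
  have hmax' : ∀ t ∈ Icc 0 T, |d t| ≤ M * Real.exp (l * t) := by
    intro t ht
    have h1 : Real.exp (-(l * t)) * |d t| ≤ M := hmax ht
    rw [Real.exp_neg, inv_mul_le_iff₀ (Real.exp_pos _)] at h1
    linarith
  have hε : 0 ≤ ε := by
    have := h 0 ⟨le_rfl, hT⟩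
    have h2 : conv (fun u => u ^ (α - 1)) (fun s => |d s|) 0 = 0 := by simp [conv]
    rw [h2] at this
    linarith [abs_nonneg (d 0)]
  have hb : conv (fun u => u ^ (α - 1)) (fun s => |d s|) x ≤
      M * Real.exp (l * x) * ((1 / l) ^ α * Real.Gamma α) := by
    have h1 := conv_mono (f := fun s => |d s|) (g := fun s => M * Real.exp (l * s)) hx.1
      (kint hα) (fun s hs => Real.rpow_nonneg hs _) hd.abs (by fun_prop)
      (fun s hs => hmax' s ⟨hs.1, hs.2.trans hx.2⟩)
    refine h1.trans ?_
    have h2 : conv (fun u => u ^ (α - 1)) (fun s => M * Real.exp (l * s)) x =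
        M * Real.exp (l * x) * ∫ u in (0:ℝ)..x, u ^ (α - 1) * Real.exp (-(l * u)) := by
      rw [conv_comm', ← intervalIntegral.integral_const_mul]
      unfold conv
      congr 1; ext s
      simp only
      rw [show l * (x - s) = l * x + -(l * s) by ring, Real.exp_add]
      ring
    rw [h2]
    exact mul_le_mul_of_nonneg_left (exp_kernel_bound hα hl0 hx.1).2 (by positivity)
  have h3 := h x hx
  have h4 : |d x| ≤ ε + M * Real.exp (l * x) / 2 := by
    calc |d x| ≤ _ := h3
      _ ≤ ε + C * (M * Real.exp (l * x) * ((1 / l) ^ α * Real.Gamma α)) := by gcongr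
      _ = ε + M * Real.exp (l * x) * (C * ((1 / l) ^ α * Real.Gamma α)) := by ring
      _ = _ := by rw [hlα]; ring
  have h5 : |d x| = M * Real.exp (l * x) := by
    rw [hM, Real.exp_neg]; field_simp
  have h6 : M ≤ 2 * ε := by
    have h7 : M * Real.exp (l * x) ≤ 2 * ε := by linarith
    have h8 : 1 ≤ Real.exp (l * x) := Real.one_le_exp (mul_nonneg hl0.le hx.1)
    nlinarith
  intro t ht
  calc |d t| ≤ M * Real.exp (l * t) := hmax' t ht
    _ ≤ (2 * ε) * Real.exp (l * T) := by
        gcongr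
        exact ht.2
    _ = _ := by ring

theorem mlS_shift {α c p t : ℝ} (hα : 0 < α) (hp : 0 ≤ p) (ht : 0 ≤ t) :
    mlS α c p t = t ^ p / Real.Gamma (p + 1) + c * mlS α c (p + α) t := by
  rw [← (mlS_hasSum hα hp ht).tsum_eq, (mlS_hasSum hα hp ht).summable.tsum_eq_zero_add]
  unfold mlS
  rw [← tsum_mul_left]
  congr 1
  · simp
  · congr 1; ext m
    push_cast
    rw [show α * (m + 1) + p = α * m + (p + α) by ring]
    ring

theorem conv_one_zero {α t : ℝ} (hα : 0 < α) :
    conv (fun u => u ^ (α - 1)) (fun _ => 1) t = t ^ α / α := by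
  rw [conv_one_right, integral_rpow (Or.inl (by linarith))]
  simp [hα.ne']

theorem stability {α σ b γ T : ℝ} (hα : α ∈ Ioo (0:ℝ) 1) (hσ : 0 < σ) (hb : 0 < b)
    (hγ : γ = b * σ ^ α / Real.Gamma (1 - α)) (hT : 0 ≤ T) :
    ∃ Q : ℝ, 0 < Q ∧ ∀ (G : ℝ → ℝ) (η : ℝ), Continuous G →
      (∀ s ∈ Icc 0 T, |σ ^ (-α) * conv (fun u => u ^ (-α)) G s + b * (∫ x in (0:ℝ)..s, G x) - s|
        ≤ η) →
      |b * (∫ x in (0:ℝ)..T, G x) - (T - mlS α (-γ) 1 T)| ≤ Q * η := by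
  obtain ⟨hα0, hα1⟩ := hα
  have hG := Real.Gamma_pos_of_pos hα0
  have hG1 := Real.Gamma_pos_of_pos (s := 1 - α) (by linarith)
  have hγ0 : 0 < γ := by rw [hγ]; positivity
  obtain ⟨Q, hQ0, hQ⟩ := gronwall_frac (C := γ / Real.Gamma α) hα0 (by positivity) hT
  refine ⟨Q * (γ / Real.Gamma α * (T ^ α / α) + 1), by positivity, ?_⟩
  intro G η hGc hη
  have hη0 : 0 ≤ η := (abs_nonneg _).trans (hη 0 ⟨le_rfl, hT⟩)
  set E : ℝ → ℝ := fun t => mlS α (-γ) 1 (max t 0) with hE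
  have hEc : Continuous E := mlS_continuous hα0 zero_le_one
  have hHc : Continuous (fun t => ∫ x in (0:ℝ)..t, G x) :=
    intervalIntegral.continuous_primitive (fun a b => hGc.intervalIntegrable a b) 0
  set d : ℝ → ℝ := fun t => b * (∫ x in (0:ℝ)..t, G x) - (t - E t) with hd
  have hdc : Continuous d := by fun_prop
  -- identity for the Mittag-Leffler side
  have idA : ∀ t, 0 ≤ t → t - E t = γ / Real.Gamma α * conv (fun u => u ^ (α - 1)) E t := by
    intro t ht
    have h1 : conv (fun u => u ^ (α - 1)) E t
        = conv (fun u => u ^ (α - 1)) (mlS α (-γ) 1) t := by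
      refine conv_congr ht (fun s _ => rfl) (fun s hs => ?_)
      simp only [hE]; rw [max_eq_left hs]
    rw [h1, conv_mlS hα0 zero_le_one hα0 ht]
    have h2 := mlS_shift (c := -γ) hα0 zero_le_one ht
    simp only [hE]
    rw [max_eq_left ht, h2, Real.rpow_one, one_add_one_eq_two, Real.Gamma_two]
    field_simp
    ring
  -- identity for the `G` side
  have hk2 : ∀ t, IntervalIntegrable (fun u : ℝ => u ^ (-α)) volume 0 t := fun t =>
    intervalIntegral.intervalIntegrable_rpow' (by linarith)
  have idB : ∀ t, 0 ≤ t → b * (∫ x in (0:ℝ)..t, G x) = γ / Real.Gamma α *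
      conv (fun u => u ^ (α - 1)) (fun s => σ ^ (-α) * conv (fun u => u ^ (-α)) G s) t := by
    intro t ht
    have h1 : conv (fun u => u ^ (α - 1)) (fun s => σ ^ (-α) * conv (fun u => u ^ (-α)) G s) t
        = σ ^ (-α) * conv (fun u => u ^ (α - 1)) (conv (fun u => u ^ (-α)) G) t := by
      unfold conv
      rw [← intervalIntegral.integral_const_mul]
      congr 1; ext s; ring
    have h2 : conv (conv (fun u => u ^ (α - 1)) (fun u => u ^ (-α))) G t
        = Real.Gamma α * Real.Gamma (1 - α) * ∫ x in (0:ℝ)..t, G x := by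
      rw [conv_comm', ← conv_one_right G, conv, conv, ← intervalIntegral.integral_const_mul]
      apply intervalIntegral.integral_congr_ae
      refine Eventually.of_forall fun s hs => ?_
      rw [uIoc_of_le ht] at hs
      have := conv_beta (β := α) (p := 1 - α) hα0 (by linarith) hs.1
      rw [show 1 - α - 1 = -α by ring, show α + (1 - α) = 1 by ring, sub_self, Real.rpow_zero,
        Real.Gamma_one] at this
      rw [this]; ring
    rw [h1, conv_assoc' ht (kint hα0) (hk2 t) hGc, h2, hγ, Real.rpow_neg hσ.le]
    have : 0 < σ ^ α := by positivity
    field_simp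
  have hmain : ∀ t ∈ Icc 0 T, |d t| ≤ γ / Real.Gamma α * (T ^ α / α) * η +
      γ / Real.Gamma α * conv (fun u => u ^ (α - 1)) (fun s => |d s|) t := by
    intro t ht
    have e : d t = γ / Real.Gamma α * ∫ s in (0:ℝ)..t, ((t - s) ^ (α - 1) *
        (σ ^ (-α) * conv (fun u => u ^ (-α)) G s) - (t - s) ^ (α - 1) * E s) := by
      rw [intervalIntegral.integral_sub]
      · simp only [hd]
        rw [idA t ht.1, idB t ht.1, mul_sub]
        rfl
      · have := (conv_assoc_aux ht.1 (kint hα0) (hk2 t) hGc).2.const_mul (σ ^ (-α))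
        refine this.congr (fun s _ => ?_)
        ring
      · exact conv_int (kint hα0) hEc
    have hI2 : IntervalIntegrable (fun s => (t - s) ^ (α - 1) * (η + |d s|)) volume 0 t :=
      conv_int (k := fun u => u ^ (α - 1)) (f := fun s => η + |d s|) (kint hα0) (by fun_prop)
    have hbnd : |∫ s in (0:ℝ)..t, ((t - s) ^ (α - 1) *
        (σ ^ (-α) * conv (fun u => u ^ (-α)) G s) - (t - s) ^ (α - 1) * E s)| ≤
        ∫ s in (0:ℝ)..t, (t - s) ^ (α - 1) * (η + |d s|) := by
      rw [← Real.norm_eq_abs]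
      refine intervalIntegral.norm_integral_le_of_norm_le ht.1 ?_ hI2
      refine Eventually.of_forall fun s hs => ?_
      rw [← mul_sub, norm_mul, Real.norm_of_nonneg (Real.rpow_nonneg (by linarith [hs.2]) _)]
      refine mul_le_mul_of_nonneg_left ?_ (Real.rpow_nonneg (by linarith [hs.2]) _)
      have h1 := hη s ⟨hs.1.le, hs.2.trans ht.2⟩
      have h2 : σ ^ (-α) * conv (fun u => u ^ (-α)) G s - E s =
        (σ ^ (-α) * conv (fun u => u ^ (-α)) G s + b * (∫ x in (0:ℝ)..s, G x) - s) - d s := by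
        simp only [hd]; ring
      rw [h2, Real.norm_eq_abs]
      exact (abs_sub _ _).trans (by gcongr)
    have hval : ∫ s in (0:ℝ)..t, (t - s) ^ (α - 1) * (η + |d s|) =
        η * (t ^ α / α) + conv (fun u => u ^ (α - 1)) (fun s => |d s|) t := by
      rw [← conv_one_zero hα0]
      unfold conv
      rw [← intervalIntegral.integral_const_mul, ← intervalIntegral.integral_add]
      · congr 1; ext s; ring
      · exact (conv_int (k := fun u => u ^ (α - 1)) (f := fun s => 1) (kint hα0)
          (by fun_prop)).const_mul η
      · exact conv_int (k := fun u => u ^ (α - 1)) (f := fun s => |d s|) (kint hα0) (by fun_prop)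
    rw [e, abs_mul, abs_of_pos (by positivity : 0 < γ / Real.Gamma α)]
    have hle : t ^ α / α ≤ T ^ α / α := by
      have := Real.rpow_le_rpow ht.1 ht.2 hα0.le
      gcongr
    calc _ ≤ γ / Real.Gamma α * (η * (t ^ α / α) +
          conv (fun u => u ^ (α - 1)) (fun s => |d s|) t) := by
          rw [← hval]; gcongr
      _ ≤ γ / Real.Gamma α * (η * (T ^ α / α) +
          conv (fun u => u ^ (α - 1)) (fun s => |d s|) t) := by gcongr
      _ = _ := by ring
  have hfin := hQ d _ hdc hmain T ⟨hT, le_rfl⟩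
  simp only [hd, hE] at hfin
  rw [max_eq_left hT] at hfin
  refine hfin.trans ?_
  nlinarith [mul_nonneg hQ0.le hη0]


theorem zeta_tendsto {α b : ℝ} (hα : 0 < α) {ζ : ℕ → ℝ}
    (hζlim : Tendsto (fun n : ℕ => (n : ℝ) ^ α * (1 - ζ n)) atTop (nhds b)) :
    Tendsto ζ atTop (nhds 1) := by
  have h1 : Tendsto (fun n : ℕ => (n : ℝ) ^ (-α)) atTop (nhds 0) :=
    (tendsto_rpow_neg_atTop hα).comp tendsto_natCast_atTop_atTop
  have h2 := (h1.mul hζlim).const_sub 1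
  rw [zero_mul, sub_zero] at h2
  refine h2.congr' ?_
  filter_upwards [eventually_ge_atTop 1] with n hn
  have hn0 : (0:ℝ) < n := by exact_mod_cast hn
  have : 0 < (n:ℝ) ^ α := by positivity
  rw [Real.rpow_neg hn0.le]
  field_simp
  ring

theorem kn_int {α σ c z s : ℝ} (hσ : 0 < σ) (hs : 0 ≤ s) {n : ℕ} (hn : 1 ≤ n) :
    IntervalIntegrable (fun u => c + z * (1 / n + σ * u) ^ (-α)) volume 0 s := by
  have hn0 : (0:ℝ) < n := by exact_mod_cast hn
  apply ContinuousOn.intervalIntegrable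
  rw [uIcc_of_le hs]
  refine continuousOn_const.add (continuousOn_const.mul ?_)
  refine ContinuousOn.rpow_const (by fun_prop) fun u hu => Or.inl ?_
  have := mul_nonneg hσ.le hu.1
  positivity

theorem k_int {α c z s : ℝ} (hα1 : α < 1) :
    IntervalIntegrable (fun u : ℝ => c + z * u ^ (-α)) volume 0 s :=
  intervalIntegrable_const.add
    ((intervalIntegral.intervalIntegrable_rpow' (by linarith)).const_mul z)

theorem kernel_L1 {α σ b T : ℝ} (hα : α ∈ Ioo (0:ℝ) 1) (hσ : 0 < σ) (hb : 0 < b) (hT : 0 ≤ T)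
    {ζ : ℕ → ℝ} (hζ : ∀ n : ℕ, 1 ≤ n → ζ n ∈ Set.Ioo (0:ℝ) 1)
    (hζlim : Tendsto (fun n : ℕ => (n : ℝ) ^ α * (1 - ζ n)) atTop (nhds b)) :
    Tendsto (fun n : ℕ => ∫ u in (0:ℝ)..T, |((n:ℝ) ^ α * (1 - ζ n) + ζ n * (1 / n + σ * u) ^ (-α))
      - (b + σ ^ (-α) * u ^ (-α))|) atTop (nhds 0) := by
  obtain ⟨hα0, hα1⟩ := hα
  have h0 : ∫ u in (0:ℝ)..T, (0:ℝ) = 0 := by simp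
  suffices h : Tendsto (fun n : ℕ => ∫ u in (0:ℝ)..T, |((n:ℝ) ^ α * (1 - ζ n) + ζ n * (1 / n + σ * u) ^ (-α))
      - (b + σ ^ (-α) * u ^ (-α))|) atTop (nhds (∫ u in (0:ℝ)..T, (0:ℝ))) by rwa [h0] at h
  apply intervalIntegral.tendsto_integral_filter_of_dominated_convergence
    (fun u => 3 * b + (2 * σ ^ (-α)) * u ^ (-α))
  · filter_upwards [eventually_ge_atTop 1] with n hn
    exact ((kn_int hσ hT hn).sub (k_int hα1)).abs.aestronglyMeasurable_restrict_uIoc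
  · filter_upwards [eventually_ge_atTop 1, hζlim.eventually (gt_mem_nhds (by linarith : b < 2 * b))]
      with n hn hbn
    refine Eventually.of_forall fun u hu => ?_
    rw [uIoc_of_le hT] at hu
    have hn0 : (0:ℝ) < n := by exact_mod_cast hn
    obtain ⟨z0, z1⟩ := hζ n hn
    have hk : (1 / n + σ * u) ^ (-α) ≤ σ ^ (-α) * u ^ (-α) := by
      rw [← Real.mul_rpow hσ.le hu.1.le]
      refine Real.rpow_le_rpow_of_nonpos (mul_pos hσ hu.1) ?_ (by linarith)
      have : 0 < 1 / (n:ℝ) := by positivity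
      linarith
    have hk0 : 0 ≤ (1 / n + σ * u) ^ (-α) := by
      have := hu.1
      positivity
    have hb0 : 0 ≤ (n:ℝ) ^ α * (1 - ζ n) := mul_nonneg (by positivity) (by linarith)
    rw [Real.norm_eq_abs, abs_abs, abs_le]
    have hzk : ζ n * (1 / n + σ * u) ^ (-α) ≤ (1 / n + σ * u) ^ (-α) := by nlinarith
    have hzk0 : 0 ≤ ζ n * (1 / n + σ * u) ^ (-α) := by positivity
    constructor <;> nlinarith
  · exact k_int hα1
  · refine Eventually.of_forall fun u hu => ?_
    rw [uIoc_of_le hT] at hu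
    have h1 : Tendsto (fun n : ℕ => (1 / (n:ℝ) + σ * u) ^ (-α)) atTop (nhds ((0 + σ * u) ^ (-α))) := by
      refine Tendsto.rpow_const (tendsto_one_div_atTop_nhds_zero_nat.add_const _) (Or.inl ?_)
      have := mul_pos hσ hu.1
      linarith
    have h2 := (((hζlim.add ((zeta_tendsto hα0 hζlim).mul h1)).sub_const
      (b + σ ^ (-α) * u ^ (-α)))).abs
    rw [zero_add, Real.mul_rpow hσ.le hu.1.le, one_mul, sub_self, abs_zero] at h2
    exact h2

theorem integral_tendsto {α σ b γ : ℝ} (hα : α ∈ Ioo (0:ℝ) 1) (hσ : 0 < σ) (hb : 0 < b)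
    (hγ : γ = b * σ ^ α / Real.Gamma (1 - α))
    {ζ : ℕ → ℝ} (hζ : ∀ n : ℕ, 1 ≤ n → ζ n ∈ Set.Ioo (0:ℝ) 1)
    (hζlim : Tendsto (fun n : ℕ => (n : ℝ) ^ α * (1 - ζ n)) atTop (nhds b))
    {G : ℕ → ℝ → ℝ} (hc : ∀ n, 1 ≤ n → Continuous (G n))
    (h0 : ∀ n, 1 ≤ n → ∀ t, 0 ≤ t → 0 ≤ G n t)
    (hle : ∀ n : ℕ, 1 ≤ n → ∀ t, 0 ≤ t → G n t ≤ 1 / ((n:ℝ) ^ α * (1 - ζ n)))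
    (hconv : ∀ n : ℕ, 1 ≤ n → ∀ t, 0 ≤ t →
        conv (fun u => (n:ℝ) ^ α * (1 - ζ n) + ζ n * (1 / n + σ * u) ^ (-α)) (G n) t = t)
    {T : ℝ} (hT : 0 ≤ T) :
    Tendsto (fun n => b * ∫ x in (0:ℝ)..T, G n x) atTop (nhds (T - mlS α (-γ) 1 T)) := by
  obtain ⟨Q, hQ0, hQ⟩ := stability hα hσ hb hγ hT
  have hL := kernel_L1 hα hσ hb hT hζ hζlim
  rw [tendsto_iff_norm_sub_tendsto_zero]
  have hL2 := hL.const_mul (Q * (2 / b))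
  rw [mul_zero] at hL2
  refine squeeze_zero' (Eventually.of_forall fun n => norm_nonneg _) ?_ hL2
  filter_upwards [eventually_ge_atTop 1,
    hζlim.eventually (lt_mem_nhds (by linarith : b / 2 < b))] with n hn hbn
  rw [Real.norm_eq_abs, mul_assoc]
  refine hQ (G n) _ (hc n hn) ?_
  intro s hs
  set kn : ℝ → ℝ := fun u => (n:ℝ) ^ α * (1 - ζ n) + ζ n * (1 / n + σ * u) ^ (-α) with hkn
  set k : ℝ → ℝ := fun u => b + σ ^ (-α) * u ^ (-α) with hk
  have hkni : ∀ s, 0 ≤ s → IntervalIntegrable kn volume 0 s := fun s hs => kn_int hσ hs hn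
  have hki : ∀ s, IntervalIntegrable k volume 0 s := fun s => k_int hα.2
  have hpi : IntervalIntegrable (fun u : ℝ => u ^ (-α)) volume 0 s :=
    intervalIntegral.intervalIntegrable_rpow' (by linarith [hα.2])
  have hGc := hc n hn
  have e1 : conv k (G n) s = σ ^ (-α) * conv (fun u => u ^ (-α)) (G n) s
      + b * ∫ x in (0:ℝ)..s, G n x := by
    unfold conv
    rw [← intervalIntegral.integral_const_mul, ← intervalIntegral.integral_const_mul,
      ← intervalIntegral.integral_add]
    · congr 1; ext x; simp only [hk]; ring
    · exact (conv_int hpi hGc).const_mul _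
    · exact (hGc.intervalIntegrable _ _).const_mul _
  have hdi : IntervalIntegrable (fun u => |kn u - k u|) volume 0 s :=
    ((hkni s hs.1).sub (hki s)).abs
  have e2 : conv k (G n) s - s = ∫ x in (0:ℝ)..s, (k (s - x) * G n x - kn (s - x) * G n x) := by
    rw [intervalIntegral.integral_sub (conv_int (hki s) hGc) (conv_int (hkni s hs.1) hGc)]
    have := hconv n hn s hs.1
    unfold conv at this ⊢
    rw [this]
  rw [← e1, e2, ← Real.norm_eq_abs]
  have hGb : ∀ x, 0 ≤ x → |G n x| ≤ 2 / b := by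
    intro x hx
    rw [abs_of_nonneg (h0 n hn x hx)]
    refine (hle n hn x hx).trans ?_
    rw [div_le_div_iff₀ (by linarith) hb]
    linarith
  have h3 : ‖∫ x in (0:ℝ)..s, (k (s - x) * G n x - kn (s - x) * G n x)‖ ≤
      ∫ x in (0:ℝ)..s, |kn (s - x) - k (s - x)| * (2 / b) := by
    refine intervalIntegral.norm_integral_le_of_norm_le hs.1 ?_ ?_
    · refine Eventually.of_forall fun x hx => ?_
      rw [← sub_mul, norm_mul, Real.norm_eq_abs, Real.norm_eq_abs, abs_sub_comm]
      exact mul_le_mul_of_nonneg_left (hGb x hx.1.le) (abs_nonneg _)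
    · exact conv_int (k := fun u => |kn u - k u|) (f := fun _ => 2 / b) hdi continuous_const
  refine h3.trans ?_
  rw [intervalIntegral.integral_mul_const, mul_comm]
  have h4 := intervalIntegral.integral_comp_sub_left (a := 0) (b := s) (fun u => |kn u - k u|) s
  rw [sub_self, sub_zero] at h4
  rw [h4]
  refine mul_le_mul_of_nonneg_left ?_ (by positivity)
  refine intervalIntegral.integral_mono_interval le_rfl hs.1 hs.2 ?_ ?_
  · exact Eventually.of_forall fun u => abs_nonneg _
  · exact ((hkni T hT).sub (hki T)).abs

theorem pointwise_of_integral {g : ℕ → ℝ → ℝ} {F : ℝ → ℝ} (hF : Continuous F)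
    (hc : ∀ n, 1 ≤ n → Continuous (g n)) (hm : ∀ n, 1 ≤ n → Monotone (g n))
    (hintg : ∀ T, 0 ≤ T →
      Tendsto (fun n => ∫ x in (0:ℝ)..T, g n x) atTop (nhds (∫ x in (0:ℝ)..T, F x)))
    {t : ℝ} (ht : 0 < t) : Tendsto (fun n => g n t) atTop (nhds (F t)) := by
  have hintg2 : ∀ x y, 0 ≤ x → 0 ≤ y →
      Tendsto (fun n => ∫ z in x..y, g n z) atTop (nhds (∫ z in x..y, F z)) := by
    intro x y hx hy
    have h1 := (hintg y hy).sub (hintg x hx)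
    rw [intervalIntegral.integral_interval_sub_left (hF.intervalIntegrable _ _)
      (hF.intervalIntegrable _ _)] at h1
    refine h1.congr' ?_
    filter_upwards [eventually_ge_atTop 1] with n hn
    exact intervalIntegral.integral_interval_sub_left ((hc n hn).intervalIntegrable _ _)
      ((hc n hn).intervalIntegrable _ _)
  rw [Metric.tendsto_nhds]
  intro ε hε
  obtain ⟨δ', hδ'0, hδ'⟩ := Metric.continuousAt_iff.1 (hF.continuousAt (x := t)) (ε / 2) (by linarith)
  set δ := min (δ' / 2) t with hδ
  have hδ0 : 0 < δ := lt_min (by linarith) ht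
  have hδt : δ ≤ t := min_le_right _ _
  have hFb : ∀ x, |x - t| ≤ δ → |F x - F t| < ε / 2 := by
    intro x hx
    refine hδ' ?_
    rw [Real.dist_eq]
    have : δ ≤ δ' / 2 := min_le_left _ _
    linarith
  have hup : ∫ z in t..(t + δ), F z ≤ δ * (F t + ε / 2) := by
    have : ∫ z in t..(t + δ), F z ≤ ∫ z in t..(t + δ), (F t + ε / 2) := by
      refine intervalIntegral.integral_mono_on (by linarith) (hF.intervalIntegrable _ _)
        intervalIntegrable_const fun x hx => ?_
      have := (abs_lt.1 (hFb x (by rw [abs_of_nonneg] <;> linarith [hx.1, hx.2]))).2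
      linarith
    rw [intervalIntegral.integral_const, smul_eq_mul, add_sub_cancel_left] at this
    exact this
  have hlo : δ * (F t - ε / 2) ≤ ∫ z in (t - δ)..t, F z := by
    have : ∫ z in (t - δ)..t, (F t - ε / 2) ≤ ∫ z in (t - δ)..t, F z := by
      refine intervalIntegral.integral_mono_on (by linarith) intervalIntegrable_const
        (hF.intervalIntegrable _ _) fun x hx => ?_
      have := (abs_lt.1 (hFb x (by rw [abs_of_nonpos] <;> linarith [hx.1, hx.2]))).1
      linarith
    rw [intervalIntegral.integral_const, smul_eq_mul, sub_sub_cancel] at this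
    exact this
  have hε' : 0 < δ * (ε / 2) := by positivity
  filter_upwards [eventually_ge_atTop 1,
    (hintg2 t (t + δ) ht.le (by linarith)).eventually
      (gt_mem_nhds (lt_add_of_pos_right _ hε')),
    (hintg2 (t - δ) t (by linarith) ht.le).eventually
      (lt_mem_nhds (sub_lt_self _ hε'))] with n hn h1 h2
  have hup2 : δ * g n t ≤ ∫ z in t..(t + δ), g n z := by
    have : ∫ z in t..(t + δ), g n t ≤ ∫ z in t..(t + δ), g n z :=
      intervalIntegral.integral_mono_on (by linarith) intervalIntegrable_const
        ((hc n hn).intervalIntegrable _ _) fun x hx => hm n hn hx.1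
    simpa using this
  have hlo2 : ∫ z in (t - δ)..t, g n z ≤ δ * g n t := by
    have : ∫ z in (t - δ)..t, g n z ≤ ∫ z in (t - δ)..t, g n t :=
      intervalIntegral.integral_mono_on (by linarith) ((hc n hn).intervalIntegrable _ _)
        intervalIntegrable_const fun x hx => hm n hn hx.2
    simpa using this
  rw [Real.dist_eq, abs_lt]
  constructor
  · have : δ * (F t - ε) < δ * g n t := by linarith
    have := lt_of_mul_lt_mul_left this hδ0.le
    linarith
  · have : δ * g n t < δ * (F t + ε) := by linarith
    have := lt_of_mul_lt_mul_left this hδ0.le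
    linarith

theorem polya {g : ℕ → ℝ → ℝ} {F : ℝ → ℝ} {c : ℕ → ℝ} {L : ℝ} (hF : Continuous F)
    (hm : ∀ n, 1 ≤ n → Monotone (g n)) (hFm : MonotoneOn F (Ici 0))
    (hFL : ∀ t, 0 ≤ t → F t ≤ L)
    (hp : ∀ t, 0 ≤ t → Tendsto (fun n => g n t) atTop (nhds (F t)))
    (hc : ∀ n, 1 ≤ n → ∀ t, 0 ≤ t → g n t ≤ c n) (hcL : Tendsto c atTop (nhds L))
    (hlim : ∀ ε, 0 < ε → ∃ t, 0 ≤ t ∧ L - ε < F t) :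
    TendstoUniformlyOn g F atTop (Ici 0) := by
  rw [Metric.tendstoUniformlyOn_iff]
  intro ε hε
  obtain ⟨T, hT0, hT⟩ := hlim (ε / 4) (by linarith)
  have huc := (isCompact_Icc (a := (0:ℝ)) (b := T + 1)).uniformContinuousOn_of_continuous
    hF.continuousOn
  rw [Metric.uniformContinuousOn_iff] at huc
  obtain ⟨δ', hδ'0, hδ'⟩ := huc (ε / 4) (by linarith)
  set δ := min (δ' / 2) 1 with hδ
  have hδ0 : 0 < δ := lt_min (by linarith) one_pos
  have hδ1 : δ ≤ 1 := min_le_right _ _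
  have hδ2 : δ < δ' := lt_of_le_of_lt (min_le_left _ _) (by linarith)
  obtain ⟨N, hN⟩ := exists_nat_gt (T / δ)
  have hall : ∀ᶠ n in atTop, ∀ j ∈ Finset.range (N + 2), |g n (j * δ) - F (j * δ)| < ε / 4 := by
    rw [Filter.eventually_all_finset]
    intro j _
    have := (Metric.tendsto_nhds.1 (hp (j * δ) (by positivity))) (ε / 4) (by linarith)
    exact this
  have hTn := (Metric.tendsto_nhds.1 (hp T hT0)) (ε / 4) (by linarith)
  have hcn := hcL.eventually (gt_mem_nhds (by linarith : L < L + ε / 4))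
  filter_upwards [eventually_ge_atTop 1, hall, hTn, hcn] with n hn h1 h2 h3
  intro t ht
  have ht : 0 ≤ t := ht
  rw [Real.dist_eq, abs_lt]
  rw [Real.dist_eq, abs_lt] at h2
  by_cases htT : T ≤ t
  · have a1 := hm n hn htT
    have a2 := hc n hn t ht
    have a3 := hFm hT0 ht htT
    have a4 := hFL t ht
    constructor <;> linarith [h2.1, h2.2]
  · push Not at htT
    set j := ⌊t / δ⌋₊ with hj
    have b1 : j * δ ≤ t := by
      have := Nat.floor_le (div_nonneg ht hδ0.le)
      rwa [le_div_iff₀ hδ0] at this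
    have b2 : t < (j + 1) * δ := by
      have := Nat.lt_floor_add_one (t / δ)
      rwa [div_lt_iff₀ hδ0] at this
    have b3 : j < N := by
      have : (j:ℝ) < N := by
        refine lt_of_le_of_lt ?_ hN
        rw [le_div_iff₀ hδ0]; linarith
      exact_mod_cast this
    have c1 := abs_lt.1 (h1 j (Finset.mem_range.2 (by omega)))
    have c2 := abs_lt.1 (h1 (j + 1) (Finset.mem_range.2 (by omega)))
    push_cast at c2
    have d1 := hm n hn b1
    have d2 := hm n hn b2.le
    have hj0 : 0 ≤ (j:ℝ) * δ := by positivity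
    have hmem : t ∈ Icc 0 (T + 1) := ⟨ht, by linarith⟩
    have hj1 : ((j:ℝ) + 1) * δ = j * δ + δ := by ring
    have e1 := hδ' (j * δ) ⟨hj0, by linarith⟩ t hmem (by
      rw [Real.dist_eq, abs_lt]; constructor <;> linarith)
    have e2 := hδ' ((j + 1) * δ) ⟨by linarith, by linarith⟩ t hmem (by
      rw [Real.dist_eq, abs_lt]; constructor <;> linarith)
    rw [Real.dist_eq, abs_lt] at e1 e2
    constructor <;> linarith [c1.1, c1.2, c2.1, c2.2, e1.1, e1.2, e2.1, e2.2]


theorem mlCDF_eq {α γ t : ℝ} (ht : 0 ≤ t) : mlCDF α γ t = 1 - mlS α (-γ) 0 t := by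
  unfold mlCDF mittagLeffler mlS
  congr 1
  refine tsum_congr fun m => ?_
  rw [mul_pow, add_zero, Real.rpow_mul ht, Real.rpow_natCast]

theorem mlS_zero_zero {α c : ℝ} (hα : 0 < α) : mlS α c 0 0 = 1 := by
  rw [mlS_shift hα le_rfl le_rfl]
  have h := conv_mlS (α := α) (c := c) (p := 0) (β := α) (t := 0) hα le_rfl hα le_rfl
  unfold conv at h
  rw [intervalIntegral.integral_same] at h
  have hG := Real.Gamma_pos_of_pos hα
  have : mlS α c (0 + α) 0 = 0 := by
    rcases mul_eq_zero.1 h.symm with h | h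
    · exact absurd h hG.ne'
    · exact h
  rw [this]
  simp

theorem integral_Fc {α c T : ℝ} (hα : 0 < α) (hT : 0 ≤ T) :
    ∫ x in (0:ℝ)..T, (1 - mlS α c 0 (max x 0)) = T - mlS α c 1 T := by
  rw [intervalIntegral.integral_sub intervalIntegrable_const
    ((mlS_continuous hα le_rfl).intervalIntegrable _ _)]
  have h := conv_mlS (α := α) (c := c) (p := 0) (β := 1) (t := T) hα le_rfl one_pos hT
  have e : (fun u : ℝ => u ^ ((1:ℝ) - 1)) = fun _ => 1 := by
    funext u; rw [sub_self, Real.rpow_zero]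
  rw [e, conv_one_left, Real.Gamma_one, one_mul, zero_add] at h
  rw [← h, intervalIntegral.integral_const, smul_eq_mul, mul_one, sub_zero]
  congr 1
  refine intervalIntegral.integral_congr fun x hx => ?_
  rw [uIcc_of_le hT] at hx
  simp only [max_eq_left hx.1]

theorem F_lim {α γ : ℝ} (hα : 0 < α) (hγ : 0 < γ)
    (h1 : ∀ t, 0 ≤ t → 1 - mlS α (-γ) 0 (max t 0) ≤ 1) {ε : ℝ} (hε : 0 < ε) :
    ∃ t, 0 ≤ t ∧ 1 - ε < 1 - mlS α (-γ) 0 (max t 0) := by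
  by_contra hcon
  push Not at hcon
  have hG := Real.Gamma_pos_of_pos hα
  have key : ∀ t, 0 ≤ t → γ / Real.Gamma α * (ε * (t ^ α / α)) ≤ 1 := by
    intro t ht
    have s1 := mlS_shift (α := α) (c := -γ) (p := 0) (t := t) hα le_rfl ht
    have s2 := conv_mlS (α := α) (c := -γ) (p := 0) (β := α) (t := t) hα le_rfl hα ht
    have s3 : conv (fun u => u ^ (α - 1)) (fun _ => ε) t
        ≤ conv (fun u => u ^ (α - 1)) (fun x => mlS α (-γ) 0 (max x 0)) t := by
      refine conv_mono ht (intervalIntegral.intervalIntegrable_rpow' (by linarith))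
        (fun s hs => Real.rpow_nonneg hs _) continuous_const (mlS_continuous hα le_rfl) ?_
      intro s hs
      have := hcon s hs.1
      linarith
    have s4 : conv (fun u => u ^ (α - 1)) (fun x => mlS α (-γ) 0 (max x 0)) t
        = conv (fun u => u ^ (α - 1)) (mlS α (-γ) 0) t := by
      unfold conv
      refine intervalIntegral.integral_congr fun x hx => ?_
      rw [uIcc_of_le ht] at hx
      simp only [max_eq_left hx.1]
    have s5 : conv (fun u => u ^ (α - 1)) (fun _ => ε) t = ε * (t ^ α / α) := by
      rw [← conv_one_zero hα]
      unfold conv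
      rw [← intervalIntegral.integral_const_mul]
      congr 1; ext x; ring
    rw [s5, s4, s2] at s3
    rw [Real.rpow_zero, zero_add, Real.Gamma_one, div_one] at s1
    have s6 := h1 t ht
    rw [max_eq_left ht] at s6
    have s6' : 1 - mlS α (-γ) 0 t ≤ 1 := s6
    have s7 : γ / Real.Gamma α * (ε * (t ^ α / α)) ≤ γ * mlS α (-γ) (0 + α) t := by
      have := mul_le_mul_of_nonneg_left s3 (div_pos hγ hG).le
      have e : γ / Real.Gamma α * (Real.Gamma α * mlS α (-γ) (0 + α) t)
          = γ * mlS α (-γ) (0 + α) t := by field_simp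
      rwa [e] at this
    have s8 := hcon t ht
    rw [max_eq_left ht] at s8
    linarith
  have hlim : Tendsto (fun t : ℝ => γ / Real.Gamma α * (ε * (t ^ α / α))) atTop atTop :=
    (((tendsto_rpow_atTop hα).atTop_div_const hα).const_mul_atTop hε).const_mul_atTop
      (div_pos hγ hG)
  obtain ⟨t, ht, ht2⟩ := ((eventually_ge_atTop (0:ℝ)).and (hlim.eventually_gt_atTop 1)).exists
  exact absurd (key t ht) (not_le.2 ht2)

theorem uniform_convergence_of_In
    (α σ b a : ℝ) (hα : α ∈ Set.Ioo (1/2 : ℝ) 1) (hσ : 0 < σ) (hb : 0 < b) (ha : 0 ≤ a)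
    (φ : ℝ → ℝ) (hφ : ∀ t : ℝ, φ t = α * σ * (1 + σ * t) ^ (-(α + 1)))
    (ζ : ℕ → ℝ) (hζ : ∀ n : ℕ, 1 ≤ n → ζ n ∈ Set.Ioo (0:ℝ) 1)
    (R : ℕ → ℝ → ℝ) (hR : ∀ n : ℕ, ∀ t : ℝ, R n t = ∑' k : ℕ, ζ n ^ (k + 1) * convPow φ k t)
    (μ : ℕ → ℝ) (hμ : ∀ n : ℕ, 1 ≤ n → 0 ≤ μ n)
    (hζlim : Tendsto (fun n : ℕ => (n : ℝ) ^ α * (1 - ζ n)) atTop (nhds b))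
    (hμlim : Tendsto (fun n : ℕ => μ n / (n : ℝ) ^ (α - 1)) atTop (nhds a))
    (γ : ℝ) (hγ : γ = b * σ ^ α / Real.Gamma (1 - α))
    (I : ℕ → ℝ → ℝ)
    (hI : ∀ n : ℕ, ∀ t : ℝ,
      I n t = (n : ℝ) ^ (1 - 2 * α) * μ n * (1 + ∫ s in (0:ℝ)..((n : ℝ) * t), R n s)) :
    TendstoUniformlyOn (fun n : ℕ => fun t : ℝ => I n t)
      (fun t : ℝ => a / b * mlCDF α γ t) atTop (Set.Ici 0) := by
  have hα0 : 0 < α := by have := hα.1; linarith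
  have hα' : α ∈ Ioo (0:ℝ) 1 := ⟨hα0, hα.2⟩
  have hγ0 : 0 < γ := by
    rw [hγ]
    have := Real.Gamma_pos_of_pos (s := 1 - α) (by linarith [hα.2])
    positivity
  have hex : ∀ n : ℕ, ∃ G : ℝ → ℝ, 1 ≤ n → Continuous G ∧ Monotone G ∧ G 0 = (n:ℝ) ^ (-α) ∧
      (∀ t, 0 ≤ t → G t ≤ 1 / ((n:ℝ) ^ α * (1 - ζ n))) ∧
      (∀ t, 0 ≤ t →
        conv (fun u => (n:ℝ) ^ α * (1 - ζ n) + ζ n * (1 / n + σ * u) ^ (-α)) G t = t) ∧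
      (∀ t, 0 ≤ t → G t = (n:ℝ) ^ (-α) *
        (1 + ∫ s in (0:ℝ)..(n * t), ∑' k : ℕ, ζ n ^ (k + 1) * convPow φ k s)) := by
    intro n
    by_cases hn : 1 ≤ n
    · obtain ⟨G, hG⟩ := scaled hα0 hσ (hζ n hn) hφ hn
      exact ⟨G, fun _ => hG⟩
    · exact ⟨fun _ => 0, fun h => absurd h hn⟩
  choose G hG using hex
  have hGc := fun n hn => (hG n hn).1
  have hGm := fun n hn => (hG n hn).2.1
  have hG0 := fun n hn => (hG n hn).2.2.1
  have hGle := fun n hn => (hG n hn).2.2.2.1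
  have hGconv := fun n hn => (hG n hn).2.2.2.2.1
  have hGeq := fun n hn => (hG n hn).2.2.2.2.2
  have hGpos : ∀ n, 1 ≤ n → ∀ t, 0 ≤ t → 0 ≤ G n t := by
    intro n hn t ht
    have h1 := hGm n hn ht
    rw [hG0 n hn] at h1
    exact le_trans (by positivity) h1
  set F : ℝ → ℝ := fun t => 1 - mlS α (-γ) 0 (max t 0) with hF
  have hFc : Continuous F := continuous_const.sub (mlS_continuous hα0 le_rfl)
  set g : ℕ → ℝ → ℝ := fun n t => b * G n t with hg
  have hgc : ∀ n, 1 ≤ n → Continuous (g n) := fun n hn => (hGc n hn).const_mul b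
  have hgm : ∀ n, 1 ≤ n → Monotone (g n) := fun n hn x y hxy =>
    mul_le_mul_of_nonneg_left (hGm n hn hxy) hb.le
  have hintg : ∀ T, 0 ≤ T →
      Tendsto (fun n => ∫ x in (0:ℝ)..T, g n x) atTop (nhds (∫ x in (0:ℝ)..T, F x)) := by
    intro T hT
    have h := integral_tendsto hα' hσ hb hγ hζ hζlim hGc hGpos hGle hGconv hT
    rw [← integral_Fc hα0 hT] at h
    simpa only [hg, intervalIntegral.integral_const_mul] using h
  have hF0 : F 0 = 0 := by
    simp only [hF, max_self, mlS_zero_zero hα0, sub_self]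
  have hp : ∀ t, 0 ≤ t → Tendsto (fun n => g n t) atTop (nhds (F t)) := by
    intro t ht
    rcases ht.eq_or_lt with rfl | ht
    · rw [hF0]
      have h1 : Tendsto (fun n : ℕ => (n : ℝ) ^ (-α)) atTop (nhds 0) :=
        (tendsto_rpow_neg_atTop hα0).comp tendsto_natCast_atTop_atTop
      have h2 := h1.const_mul b
      rw [mul_zero] at h2
      refine h2.congr' ?_
      filter_upwards [eventually_ge_atTop 1] with n hn
      simp only [hg, hG0 n hn]
    · exact pointwise_of_integral hFc hgc hgm hintg ht
  set c : ℕ → ℝ := fun n => b * (1 / ((n:ℝ) ^ α * (1 - ζ n))) with hcdef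
  have hcL : Tendsto c atTop (nhds 1) := by
    have h := (hζlim.inv₀ hb.ne').const_mul b
    rw [mul_inv_cancel₀ hb.ne'] at h
    simpa only [hcdef, one_div] using h
  have hgle : ∀ n, 1 ≤ n → ∀ t, 0 ≤ t → g n t ≤ c n := fun n hn t ht =>
    mul_le_mul_of_nonneg_left (hGle n hn t ht) hb.le
  have hFm : MonotoneOn F (Ici 0) := by
    intro x hx y hy hxy
    refine le_of_tendsto_of_tendsto (hp x hx) (hp y hy) ?_
    filter_upwards [eventually_ge_atTop 1] with n hn
    exact hgm n hn hxy
  have hF1 : ∀ t, 0 ≤ t → F t ≤ 1 := by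
    intro t ht
    refine le_of_tendsto_of_tendsto (hp t ht) hcL ?_
    filter_upwards [eventually_ge_atTop 1] with n hn
    exact hgle n hn t ht
  have hFnn : ∀ t, 0 ≤ t → 0 ≤ F t := by
    intro t ht
    rw [← hF0]
    exact hFm (Set.mem_Ici.2 le_rfl) ht ht
  have hunif := polya hFc hgm hFm hF1 hp hgle hcL (fun ε hε => F_lim hα0 hγ0 hF1 hε)
  have hIeq : ∀ n : ℕ, 1 ≤ n → ∀ t, 0 ≤ t →
      I n t = μ n / (n:ℝ) ^ (α - 1) / b * g n t := by
    intro n hn t ht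
    have hn0 : (0:ℝ) < n := by exact_mod_cast hn
    have hRf : R n = fun s => ∑' k : ℕ, ζ n ^ (k + 1) * convPow φ k s := funext (hR n)
    have e1 : (n:ℝ) ^ (1 - 2 * α) = (n:ℝ) ^ (-α) / (n:ℝ) ^ (α - 1) := by
      rw [← Real.rpow_sub hn0]; congr 1; ring
    rw [hI, hRf, e1]
    simp only [hg]
    rw [hGeq n hn t ht]
    field_simp
  rw [Metric.tendstoUniformlyOn_iff] at hunif ⊢
  intro ε hε
  have hq : Tendsto (fun n : ℕ => μ n / (n:ℝ) ^ (α - 1) / b) atTop (nhds (a / b)) :=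
    hμlim.div_const b
  have hK : 0 < a / b + 1 := by positivity
  filter_upwards [eventually_ge_atTop 1, hunif (ε / 2 / (a / b + 1)) (by positivity),
    Metric.tendsto_nhds.1 hq (ε / 2) (by linarith),
    hq.eventually (gt_mem_nhds (lt_add_one (a / b)))] with n hn h1 h2 h3
  intro t ht
  have ht0 : 0 ≤ t := ht
  have h1t := h1 t ht
  have hFt : mlCDF α γ t = F t := by
    rw [mlCDF_eq ht0]
    simp only [hF, max_eq_left ht0]
  have hq0 : 0 ≤ μ n / (n:ℝ) ^ (α - 1) / b := by
    have := hμ n hn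
    positivity
  simp only [hFt, hIeq n hn t ht0]
  set q := μ n / (n:ℝ) ^ (α - 1) / b with hqdef
  rw [Real.dist_eq] at h1t h2 ⊢
  have e : a / b * F t - q * g n t = q * (F t - g n t) - (q - a / b) * F t := by ring
  rw [e]
  have h5 : q * |F t - g n t| ≤ ε / 2 := by
    have : |F t - g n t| * (a / b + 1) < ε / 2 := by rwa [lt_div_iff₀ hK] at h1t
    nlinarith [abs_nonneg (F t - g n t)]
  have h6 : |q - a / b| * F t ≤ |q - a / b| := by
    nlinarith [abs_nonneg (q - a / b), hF1 t ht0]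
  calc |q * (F t - g n t) - (q - a / b) * F t|
      ≤ |q * (F t - g n t)| + |(q - a / b) * F t| := abs_sub _ _
    _ = q * |F t - g n t| + |q - a / b| * F t := by
        rw [abs_mul, abs_mul, abs_of_nonneg hq0, abs_of_nonneg (hFnn t ht0)]
    _ < ε := by linarith
end

section
/- Let α ∈ (0,1) and γ > 0. For every λ ≥ 0, the function t ↦ e^{−λt} f^{α,γ}(t) is integrable on (0,∞) and the Laplace transform of the Mittag-Leffler density satisfies ∫_0^∞ e^{−λt} γ t^{α−1} E_{α,α}(−γ t^α) dt = γ/(γ + λ^α). -/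
open MeasureTheory Real Filter Set

/-- The Mittag-Leffler density `f^{a,g}(t) = g t^{a-1} E_{a,a}(-g t^a)`. -/
noncomputable def mlDensity (a g t : ℝ) : ℝ := g * t ^ (a - 1) * mittagLeffler a a (-g * t ^ a)


lemma ml_beta (s t a : ℝ) (hs : 0 < s) (ht : 0 < t) (ha : 0 < a) :
    ∫ x in (0:ℝ)..a, x ^ (s - 1) * (a - x) ^ (t - 1)
      = a ^ (s + t - 1) * (Real.Gamma s * Real.Gamma t / Real.Gamma (s + t)) := by
  have h := Complex.betaIntegral_scaled (s : ℂ) (t : ℂ) ha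
  rw [Complex.betaIntegral_eq_Gamma_mul_div _ _ (by simpa) (by simpa)] at h
  have e : ∫ x in (0:ℝ)..a, (x : ℂ) ^ ((s:ℂ) - 1) * ((a : ℂ) - x) ^ ((t:ℂ) - 1)
      = ∫ x in (0:ℝ)..a, ((x ^ (s - 1) * (a - x) ^ (t - 1) : ℝ) : ℂ) := by
    apply intervalIntegral.integral_congr
    intro x hx
    rw [uIcc_of_le ha.le] at hx
    simp only
    rw [Complex.ofReal_mul, Complex.ofReal_cpow hx.1, Complex.ofReal_cpow (by linarith [hx.2])]
    push_cast
    rfl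
  rw [e, intervalIntegral.integral_ofReal] at h
  have h2 : (a : ℂ) ^ ((s:ℂ) + t - 1) = ((a ^ (s + t - 1) : ℝ) : ℂ) := by
    rw [Complex.ofReal_cpow ha.le]; push_cast; rfl
  rw [h2, ← Complex.ofReal_add, Complex.Gamma_ofReal, Complex.Gamma_ofReal,
    Complex.Gamma_ofReal] at h
  exact_mod_cast h

lemma ml_beta_int (s t a : ℝ) (hs : 0 < s) (ht : 0 < t) (ha : 0 < a) :
    IntervalIntegrable (fun x => x ^ (s - 1) * (a - x) ^ (t - 1)) volume 0 a := by
  by_contra hn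
  have h := ml_beta s t a hs ht ha
  rw [intervalIntegral.integral_undef hn] at h
  have := Real.Gamma_pos_of_pos hs
  have := Real.Gamma_pos_of_pos ht
  have := Real.Gamma_pos_of_pos (add_pos hs ht)
  have : 0 < a ^ (s + t - 1) * (Real.Gamma s * Real.Gamma t / Real.Gamma (s + t)) := by positivity
  linarith

lemma ml_gamma_growth (x a : ℝ) (hx : 1 < x) (ha : 0 < a) :
    (x - 1) ^ a * Real.Gamma x ≤ Real.Gamma (x + a) := by
  have h := Real.convexOn_log_Gamma.slope_mono_adjacent (x := x - 1) (y := x) (z := x + a)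
    (by simp; linarith) (by simp; linarith) (by linarith) (by linarith)
  have g : Real.Gamma x = (x - 1) * Real.Gamma (x - 1) := by
    have := Real.Gamma_add_one (s := x - 1) (by linarith)
    rwa [sub_add_cancel] at this
  have p1 : 0 < Real.Gamma (x - 1) := Real.Gamma_pos_of_pos (by linarith)
  have p2 : 0 < Real.Gamma x := Real.Gamma_pos_of_pos (by linarith)
  have p3 : 0 < Real.Gamma (x + a) := Real.Gamma_pos_of_pos (by linarith)
  have e : Real.log (Real.Gamma x) = Real.log (x - 1) + Real.log (Real.Gamma (x - 1)) := by
    rw [g, Real.log_mul (by linarith) p1.ne']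
  simp only [Function.comp] at h
  rw [sub_sub_cancel, add_sub_cancel_left, div_one, le_div_iff₀ ha] at h
  rw [← Real.log_le_log_iff (mul_pos (Real.rpow_pos_of_pos (by linarith) _) p2) p3,
    Real.log_mul (Real.rpow_pos_of_pos (by linarith) _).ne' p2.ne', Real.log_rpow (by linarith)]
  nlinarith

lemma ml_summable (a : ℝ) (ha : 0 < a) (x : ℝ) :
    Summable fun m : ℕ => x ^ m / Real.Gamma (a * m + a) := by
  by_cases hx : x = 0
  · subst hx
    apply summable_of_ne_finset_zero (s := {0})
    intro b hb
    simp at hb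
    simp [hb]
  have hG : ∀ m : ℕ, 0 < Real.Gamma (a * m + a) := fun m => Real.Gamma_pos_of_pos (by positivity)
  apply summable_of_ratio_test_tendsto_lt_one (l := 0) one_pos
  · exact Eventually.of_forall fun m => div_ne_zero (pow_ne_zero _ hx) (hG m).ne'
  have hl : Tendsto (fun m : ℕ => a * (m:ℝ) + a - 1) atTop atTop := by
    have : Tendsto (fun m : ℕ => a * (m:ℝ)) atTop atTop :=
      Tendsto.const_mul_atTop ha tendsto_natCast_atTop_atTop
    simpa [add_sub_assoc] using tendsto_atTop_add_const_right _ (a - 1) this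
  have hl2 : Tendsto (fun m : ℕ => |x| * ((a * (m:ℝ) + a - 1) ^ a)⁻¹) atTop (nhds 0) := by
    simpa using (((tendsto_rpow_atTop ha).comp hl).inv_tendsto_atTop).const_mul |x|
  refine squeeze_zero' (Eventually.of_forall fun m => by positivity) ?_ hl2
  filter_upwards [hl.eventually_gt_atTop 0] with m hm
  have hg := ml_gamma_growth (a * m + a) a (by linarith) ha
  have hp : 0 < (a * (m:ℝ) + a - 1) ^ a := Real.rpow_pos_of_pos hm _
  have e : a * ((m + 1 : ℕ):ℝ) + a = a * m + a + a := by push_cast; ring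
  have h3 : 0 < Real.Gamma (a * m + a + a) := Real.Gamma_pos_of_pos (by positivity)
  rw [e, norm_div, norm_div, norm_pow, norm_pow, Real.norm_of_nonneg (hG m).le,
    Real.norm_of_nonneg h3.le, Real.norm_eq_abs]
  have hxp : 0 < |x| := abs_pos.mpr hx
  have : |x| ^ (m + 1) / Real.Gamma (a * m + a + a) / (|x| ^ m / Real.Gamma (a * m + a))
    = |x| * (Real.Gamma (a * m + a) / Real.Gamma (a * m + a + a)) := by
    have := (hG m).ne'
    field_simp
    ring
  rw [this]
  gcongr
  rw [div_le_iff₀ h3, inv_mul_eq_div, le_div_iff₀ hp, mul_comm]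
  exact hg

/-- abstract positivity -/
lemma ml_pos (a c : ℝ) (ha : 0 < a) (ha1 : a < 1) (hc : 0 < c) (f : ℝ → ℝ)
    (hf : ContinuousOn f (Ioi 0))
    (hi : ∀ t, 0 < t → IntervalIntegrable (fun s => f s * (t - s) ^ (a - 1)) volume 0 t)
    (hv : ∀ t, 0 < t → ∫ s in (0:ℝ)..t, f s * (t - s) ^ (a - 1) = t ^ (a - 1) - c * f t)
    (e : ℝ) (he : 0 < e) (hfe : ∀ t, 0 < t → t < e → 0 < f t) :
    ∀ t, 0 < t → 0 < f t := by
  by_contra! hcon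
  obtain ⟨t1, ht1, hft1⟩ := hcon
  let S := {t : ℝ | 0 < t ∧ f t ≤ 0}
  have hSe : ∀ t ∈ S, e ≤ t := fun t ht => by
    by_contra! h
    exact absurd (hfe t ht.1 h) (not_lt.mpr ht.2)
  have hSb : BddBelow S := ⟨e, hSe⟩
  have hSn : S.Nonempty := ⟨t1, ht1, hft1⟩
  set t0 := sInf S with ht0
  have hpos : 0 < t0 := he.trans_le (le_csInf hSn hSe)
  have hlt : ∀ t, 0 < t → t < t0 → 0 < f t := fun t h hh2 => by
    by_contra! hh
    exact absurd (csInf_le hSb (show t ∈ S from ⟨h, hh⟩)) (not_le.mpr hh2)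
  have hft0 : f t0 ≤ 0 := by
    have hcl := csInf_mem_closure hSn hSb
    have hca : ContinuousAt f t0 := hf.continuousAt (Ioi_mem_nhds hpos)
    by_contra! hh
    have := hca.eventually (lt_mem_nhds hh)
    rw [mem_closure_iff_frequently] at hcl
    obtain ⟨x, hx, hx2⟩ := (hcl.and_eventually this).exists
    exact absurd hx2 (not_lt.mpr hx.2)
  obtain ⟨d, hd, hd2, hdc⟩ : ∃ d : ℝ, 0 < d ∧ d ≤ t0 / 2 ∧ 2 * (d ^ a / a) < c := by
    have h1 : Tendsto (fun d : ℝ => 2 * (d ^ a / a)) (nhdsWithin 0 (Ioi 0)) (nhds 0) := by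
      have : ContinuousAt (fun d : ℝ => 2 * (d ^ a / a)) 0 := by
        have := Real.continuousAt_rpow_const 0 a (Or.inr ha.le)
        fun_prop
      have h := this.tendsto
      simp only [Real.zero_rpow ha.ne', zero_div, mul_zero] at h
      exact h.mono_left nhdsWithin_le_nhds
    have h2 := h1.eventually (gt_mem_nhds hc)
    have h3 : ∀ᶠ d : ℝ in nhdsWithin 0 (Ioi 0), d < t0 / 2 :=
      nhdsWithin_le_nhds (gt_mem_nhds (by positivity))
    obtain ⟨d, ⟨hda, hdb⟩, hdd⟩ := ((h2.and h3).and self_mem_nhdsWithin).exists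
    exact ⟨d, hdd, hdb.le, hda⟩
  obtain ⟨u, hu, hmax⟩ := isCompact_Icc.exists_isMaxOn (s := Icc (t0 - d) t0)
    ⟨t0, by constructor <;> linarith⟩ (hf.mono fun x hx => by
      have := hx.1
      simp only [mem_Ioi]; linarith)
  have hfu : 0 < f u := by
    have : f (t0 - d) ≤ f u := hmax (show t0 - d ∈ Icc (t0 - d) t0 by constructor <;> linarith)
    exact (hlt _ (by linarith) (by linarith)).trans_le this
  have hu0 : 0 < u := by linarith [hu.1]
  have hut : u < t0 := by
    rcases hu.2.lt_or_eq with h | h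
    · exact h
    · rw [h] at hfu; linarith
  set r := (u / t0) ^ (a - 1) with hr
  have hr0 : 0 < r := Real.rpow_pos_of_pos (by positivity) _
  have hr2 : r ≤ 2 := by
    calc r ≤ (1/2 : ℝ) ^ (a - 1) := by
          apply Real.rpow_le_rpow_of_nonpos (by norm_num) _ (by linarith)
          rw [le_div_iff₀ hpos]; linarith [hu.1]
      _ ≤ (1/2 : ℝ) ^ (-1 : ℝ) :=
          Real.rpow_le_rpow_of_exponent_ge (by norm_num) (by norm_num) (by linarith)
      _ = 2 := by rw [Real.rpow_neg_one]; norm_num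
  have hru : u ^ (a - 1) = r * t0 ^ (a - 1) := by
    rw [hr, ← Real.mul_rpow (by positivity) hpos.le, div_mul_cancel₀ _ hpos.ne']
  have hiu := hi u hu0
  have hi0 := hi t0 hpos
  have hia : IntervalIntegrable (fun s => f s * (t0 - s) ^ (a - 1)) volume 0 u :=
    hi0.mono_set (by rw [uIcc_of_le hu0.le, uIcc_of_le hpos.le]; exact Icc_subset_Icc_right hut.le)
  have hib : IntervalIntegrable (fun s => f s * (t0 - s) ^ (a - 1)) volume u t0 :=
    hi0.mono_set (by rw [uIcc_of_le hut.le, uIcc_of_le hpos.le]; exact Icc_subset_Icc_left hu0.le)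
  have hsplit := intervalIntegral.integral_add_adjacent_intervals hia hib
  have hI1 : r * ∫ s in (0:ℝ)..u, f s * (t0 - s) ^ (a - 1)
      ≤ ∫ s in (0:ℝ)..u, f s * (u - s) ^ (a - 1) := by
    rw [← intervalIntegral.integral_const_mul]
    apply intervalIntegral.integral_mono_on_of_le_Ioo hu0.le (hia.const_mul r) hiu
    intro s hs
    have h0 : 0 < f s := hlt s hs.1 (hs.2.trans hut)
    have h1 : 0 < u - s := by linarith [hs.2]
    have h2 : 0 < t0 - s := by linarith
    have : r * (t0 - s) ^ (a - 1) ≤ (u - s) ^ (a - 1) := by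
      rw [hr, ← Real.mul_rpow (by positivity) h2.le]
      apply Real.rpow_le_rpow_of_nonpos h1 _ (by linarith)
      rw [div_mul_eq_mul_div, le_div_iff₀ hpos]
      nlinarith [hs.1]
    nlinarith
  have hpi : IntervalIntegrable (fun s => (t0 - s) ^ (a - 1)) volume u t0 := by
    have := (intervalIntegral.intervalIntegrable_rpow' (a := t0 - u) (b := 0) (r := a - 1)
      (by linarith)).comp_sub_left t0
    simpa using this
  have hpv : ∫ s in u..t0, (t0 - s) ^ (a - 1) = (t0 - u) ^ a / a := by
    rw [intervalIntegral.integral_comp_sub_left (fun s => s ^ (a - 1)) t0, sub_self,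
      integral_rpow (Or.inl (by linarith)), sub_add_cancel, Real.zero_rpow ha.ne', sub_zero]
  have hI2 : ∫ s in u..t0, f s * (t0 - s) ^ (a - 1) ≤ f u * ((t0 - u) ^ a / a) := by
    rw [← hpv, ← intervalIntegral.integral_const_mul]
    apply intervalIntegral.integral_mono_on_of_le_Ioo hut.le hib (hpi.const_mul _)
    intro s hs
    have : f s ≤ f u := hmax ⟨by linarith [hs.1, hu.1], hs.2.le⟩
    have h2 : 0 < t0 - s := by linarith [hs.2]
    gcongr
  have hle : (t0 - u) ^ a / a ≤ d ^ a / a := by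
    gcongr
    linarith [hu.1]
  have e1 := hv u hu0
  have e2 := hv t0 hpos
  have hcf : c * f t0 ≤ 0 := mul_nonpos_of_nonneg_of_nonpos hc.le hft0
  have k0 : t0 ^ (a - 1) ≤ (∫ s in (0:ℝ)..u, f s * (t0 - s) ^ (a - 1))
      + f u * (d ^ a / a) := by
    have := mul_le_mul_of_nonneg_left hle hfu.le
    linarith
  have k1 : r * t0 ^ (a - 1) ≤ r * (∫ s in (0:ℝ)..u, f s * (t0 - s) ^ (a - 1))
      + r * (f u * (d ^ a / a)) := by
    rw [← mul_add]; gcongr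
  have k2 : r * (f u * (d ^ a / a)) ≤ 2 * (f u * (d ^ a / a)) := by gcongr
  have k3 : f u * (2 * (d ^ a / a)) < f u * c := by gcongr
  linarith

lemma ml_cont (a : ℝ) (ha : 0 < a) : Continuous (mittagLeffler a a) := by
  rw [continuous_iff_continuousAt]
  intro x
  have hG : ∀ m : ℕ, 0 < Real.Gamma (a * m + a) := fun m => Real.Gamma_pos_of_pos (by positivity)
  have h : ContinuousOn (mittagLeffler a a) (Icc (-(|x| + 1)) (|x| + 1)) := by
    unfold mittagLeffler
    apply continuousOn_tsum (u := fun m : ℕ => (|x| + 1) ^ m / Real.Gamma (a * m + a))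
    · intro m
      fun_prop
    · exact ml_summable a ha _
    · intro m y hy
      rw [norm_div, norm_pow, Real.norm_of_nonneg (hG m).le, Real.norm_eq_abs]
      have := abs_le.mpr hy
      have := hG m
      gcongr
  apply h.continuousAt
  apply Icc_mem_nhds
  · linarith [neg_abs_le x]
  · linarith [le_abs_self x]

lemma ml_density_cont (a g : ℝ) (ha : 0 < a) : ContinuousOn (mlDensity a g) (Ioi 0) := by
  unfold mlDensity
  apply ContinuousOn.mul
  · apply continuousOn_const.mul
    exact continuousOn_id.rpow_const fun x hx => Or.inl (ne_of_gt hx)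
  · apply (ml_cont a ha).comp_continuousOn
    apply continuousOn_const.mul
    exact continuousOn_id.rpow_const fun x hx => Or.inl (ne_of_gt hx)

lemma ml_bound (a g : ℝ) (ha : 0 < a) (T : ℝ) :
    ∃ C : ℝ, 0 ≤ C ∧ ∀ t, 0 < t → t ≤ T → ‖mlDensity a g t‖ ≤ C * t ^ (a - 1) := by
  have hc : Continuous fun t : ℝ => mittagLeffler a a (-g * t ^ a) := by
    apply (ml_cont a ha).comp
    exact continuous_const.mul (Real.continuous_rpow_const ha.le)
  obtain ⟨C, hC⟩ := (isCompact_Icc (a := (0:ℝ)) (b := T)).exists_bound_of_continuousOn hc.continuousOn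
  refine ⟨|g| * max C 0, by positivity, fun t ht htT => ?_⟩
  have h := hC t ⟨ht.le, htT⟩
  unfold mlDensity
  rw [norm_mul, norm_mul, Real.norm_eq_abs g, Real.norm_of_nonneg (Real.rpow_nonneg ht.le _)]
  have : ‖mittagLeffler a a (-g * t ^ a)‖ ≤ max C 0 := h.trans (le_max_left _ _)
  have hp : 0 ≤ t ^ (a - 1) := Real.rpow_nonneg ht.le _
  calc |g| * t ^ (a - 1) * ‖mittagLeffler a a (-g * t ^ a)‖
      ≤ |g| * t ^ (a - 1) * max C 0 := by gcongr
    _ = _ := by ring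

lemma ml_meas (a g T : ℝ) (ha : 0 < a) :
    AEStronglyMeasurable (mlDensity a g) (volume.restrict (Ioc 0 T)) :=
  ((ml_density_cont a g ha).mono fun _ hx => hx.1).aestronglyMeasurable measurableSet_Ioc

lemma ml_int (a g t : ℝ) (ha : 0 < a) (ht : 0 < t) :
    IntervalIntegrable (mlDensity a g) volume 0 t := by
  obtain ⟨C, hC, hb⟩ := ml_bound a g ha t
  have h := (intervalIntegral.intervalIntegrable_rpow' (a := 0) (b := t) (r := a - 1)
      (by linarith)).const_mul C
  rw [intervalIntegrable_iff_integrableOn_Ioc_of_le ht.le] at h ⊢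
  refine Integrable.mono' h (ml_meas a g t ha) ?_
  filter_upwards [ae_restrict_mem measurableSet_Ioc] with s hs
  exact hb s hs.1 hs.2

lemma ml_conv_int (a g t : ℝ) (ha : 0 < a) (ht : 0 < t) :
    IntervalIntegrable (fun s => mlDensity a g s * (t - s) ^ (a - 1)) volume 0 t := by
  obtain ⟨C, hC, hb⟩ := ml_bound a g ha t
  have h := (ml_beta_int a a t ha ha ht).const_mul C
  rw [intervalIntegrable_iff_integrableOn_Ioc_of_le ht.le] at h ⊢
  refine Integrable.mono' h ((ml_meas a g t ha).mul ?_) ?_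
  · exact (Measurable.pow_const (by fun_prop) _).aestronglyMeasurable
  filter_upwards [ae_restrict_mem measurableSet_Ioc] with s hs
  have h1 : 0 ≤ (t - s) ^ (a - 1) := Real.rpow_nonneg (by linarith [hs.2]) _
  rw [norm_mul, Real.norm_of_nonneg h1, ← mul_assoc]
  have := hb s hs.1 hs.2
  gcongr

/-- terms of the series -/
lemma ml_term (a g t : ℝ) (ht : 0 < t) (m : ℕ) :
    g * t ^ (a - 1) * ((-g * t ^ a) ^ m / Real.Gamma (a * m + a))
      = g * (-g) ^ m / Real.Gamma (a * m + a) * t ^ (a * m + a - 1) := by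
  have : t ^ (a * m + a - 1) = t ^ (a - 1) * (t ^ a) ^ m := by
    rw [← Real.rpow_natCast, ← Real.rpow_mul ht.le, ← Real.rpow_add ht]
    congr 1; ring
  rw [this, mul_pow]; ring

lemma ml_hasSum (a g t : ℝ) (ha : 0 < a) (ht : 0 < t) :
    HasSum (fun m : ℕ => g * (-g) ^ m / Real.Gamma (a * m + a) * t ^ (a * m + a - 1))
      (mlDensity a g t) := by
  simp_rw [← ml_term a g t ht]
  exact (ml_summable a ha _).hasSum.mul_left _

lemma ml_summable_abs (a g t : ℝ) (ha : 0 < a) (hg : 0 < g) (ht : 0 < t) :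
    Summable (fun m : ℕ => g * g ^ m / Real.Gamma (a * m + a) * t ^ (a * m + a - 1)) := by
  have h := (ml_summable a ha (g * t ^ a)).mul_left (g * t ^ (a - 1))
  refine h.congr fun m => ?_
  have : t ^ (a * m + a - 1) = t ^ (a - 1) * (t ^ a) ^ m := by
    rw [← Real.rpow_natCast, ← Real.rpow_mul ht.le, ← Real.rpow_add ht]
    congr 1; ring
  rw [this, mul_pow]; ring

lemma ml_volterra (a g t : ℝ) (ha : 0 < a) (hg : 0 < g) (ht : 0 < t) :
    ∫ s in (0:ℝ)..t, mlDensity a g s * (t - s) ^ (a - 1)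
      = t ^ (a - 1) - Real.Gamma a / g * mlDensity a g t := by
  have hG : ∀ m : ℕ, 0 < Real.Gamma (a * m + a) := fun m => Real.Gamma_pos_of_pos (by positivity)
  have hGa : 0 < Real.Gamma a := Real.Gamma_pos_of_pos ha
  let F : ℕ → ℝ → ℝ := fun m s =>
    g * (-g) ^ m / Real.Gamma (a * m + a) * (s ^ (a * m + a - 1) * (t - s) ^ (a - 1))
  have hFi : ∀ m, IntegrableOn (F m) (Ioc 0 t) := fun m => by
    rw [← intervalIntegrable_iff_integrableOn_Ioc_of_le ht.le]
    exact (ml_beta_int (a * m + a) a t (by positivity) ha ht).const_mul _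
  have hb : ∀ m : ℕ, ∫ s in Ioc 0 t, s ^ (a * m + a - 1) * (t - s) ^ (a - 1)
      = t ^ (a * (m + 1 : ℕ) + a - 1) * (Real.Gamma (a * m + a) * Real.Gamma a
        / Real.Gamma (a * (m + 1 : ℕ) + a)) := fun m => by
    rw [← intervalIntegral.integral_of_le ht.le, ml_beta (a * m + a) a t (by positivity) ha ht]
    have : a * m + a + a = a * (m + 1 : ℕ) + a := by push_cast; ring
    rw [this]
  have hFv : ∀ m : ℕ, ∫ s in Ioc 0 t, F m s = -(Real.Gamma a / g) *
      (g * (-g) ^ (m + 1) / Real.Gamma (a * (m + 1 : ℕ) + a) * t ^ (a * (m + 1 : ℕ) + a - 1)) :=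
    fun m => by
      simp only [F]
      rw [integral_const_mul, hb]
      have := (hG m).ne'
      have := (hG (m + 1)).ne'
      field_simp
      ring
  have hFn : ∀ m : ℕ, ∫ s in Ioc 0 t, ‖F m s‖ = (Real.Gamma a / g) *
      (g * g ^ (m + 1) / Real.Gamma (a * (m + 1 : ℕ) + a) * t ^ (a * (m + 1 : ℕ) + a - 1)) :=
    fun m => by
      have : ∫ s in Ioc 0 t, ‖F m s‖ = ∫ s in Ioc 0 t, g * g ^ m / Real.Gamma (a * m + a) *
          (s ^ (a * m + a - 1) * (t - s) ^ (a - 1)) := by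
        apply setIntegral_congr_fun measurableSet_Ioc
        intro s hs
        have h1 : 0 ≤ s ^ (a * m + a - 1) := Real.rpow_nonneg hs.1.le _
        have h2 : 0 ≤ (t - s) ^ (a - 1) := Real.rpow_nonneg (by linarith [hs.2]) _
        simp only [F]
        rw [norm_mul, norm_div, norm_mul, norm_pow, norm_neg, Real.norm_of_nonneg hg.le,
          Real.norm_of_nonneg (hG m).le, Real.norm_of_nonneg (mul_nonneg h1 h2)]
      rw [this, integral_const_mul, hb]
      have := (hG m).ne'
      have := (hG (m + 1)).ne'
      field_simp
      ring
  have hS := hasSum_integral_of_summable_integral_norm (μ := volume.restrict (Ioc 0 t)) hFi (by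
    simp_rw [hFn]
    exact ((summable_nat_add_iff 1).mpr (ml_summable_abs a g t ha hg ht)).mul_left _)
  simp_rw [hFv] at hS
  have hS2 := (((hasSum_nat_add_iff' 1).mpr (ml_hasSum a g t ha ht)).mul_left (-(Real.Gamma a / g)))
  have key := hS.unique hS2
  rw [intervalIntegral.integral_of_le ht.le]
  have hL : ∫ s in Ioc 0 t, mlDensity a g s * (t - s) ^ (a - 1)
      = ∫ s in Ioc 0 t, ∑' m, F m s := by
    apply setIntegral_congr_fun measurableSet_Ioc
    intro s hs
    have := (ml_hasSum a g s ha hs.1).mul_right ((t - s) ^ (a - 1))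
    simp only [F, ← mul_assoc]
    exact this.tsum_eq.symm
  rw [hL, key]
  simp
  field_simp
  ring

lemma ml_density_pos (a g : ℝ) (ha : 0 < a) (ha1 : a < 1) (hg : 0 < g) :
    ∀ t, 0 < t → 0 < mlDensity a g t := by
  have hGa : 0 < Real.Gamma a := Real.Gamma_pos_of_pos ha
  have h0 : 0 < mittagLeffler a a 0 := by
    unfold mittagLeffler
    rw [tsum_eq_single 0 (fun m hm => by simp [hm])]
    simpa using hGa
  have hc : Continuous fun t : ℝ => mittagLeffler a a (-g * t ^ a) := by
    apply (ml_cont a ha).comp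
    exact continuous_const.mul (Real.continuous_rpow_const ha.le)
  have he : ∀ᶠ t in nhds (0:ℝ), 0 < mittagLeffler a a (-g * t ^ a) := by
    apply hc.continuousAt.eventually (lt_mem_nhds _)
    simpa [Real.zero_rpow ha.ne'] using h0
  obtain ⟨e, he, hb⟩ := Metric.eventually_nhds_iff.mp he
  apply ml_pos a (Real.Gamma a / g) ha ha1 (by positivity) _ (ml_density_cont a g ha)
    (fun t ht => ml_conv_int a g t ha ht) (fun t ht => ml_volterra a g t ha hg ht) e he
  intro t ht hte
  have := hb (y := t) (by simpa [abs_of_pos ht] using hte)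
  unfold mlDensity
  have := Real.rpow_pos_of_pos ht (a - 1)
  positivity

lemma ml_integrable (a g : ℝ) (ha : 0 < a) (ha1 : a < 1) (hg : 0 < g) :
    IntegrableOn (mlDensity a g) (Ioi 0) := by
  have hGa : 0 < Real.Gamma a := Real.Gamma_pos_of_pos ha
  have hp := ml_density_pos a g ha ha1 hg
  refine integrableOn_Ioi_of_intervalIntegral_norm_bounded (l := atTop) (b := fun t : ℝ => t)
    1 0 (fun t => ?_) tendsto_id ?_
  · rcases le_or_gt t 0 with h | h
    · simp [Ioc_eq_empty (not_lt.mpr h)]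
    · exact (intervalIntegrable_iff_integrableOn_Ioc_of_le h.le).mp (ml_int a g t ha h)
  · filter_upwards [eventually_gt_atTop 0] with t ht
    have e : ∫ s in (0:ℝ)..t, ‖mlDensity a g s‖ = ∫ s in (0:ℝ)..t, mlDensity a g s := by
      rw [intervalIntegral.integral_of_le ht.le, intervalIntegral.integral_of_le ht.le]
      apply setIntegral_congr_fun measurableSet_Ioc
      intro s hs
      exact Real.norm_of_nonneg (hp s hs.1).le
    rw [e]
    have hk : 0 < t ^ (a - 1) := Real.rpow_pos_of_pos ht _
    have h1 : t ^ (a - 1) * ∫ s in (0:ℝ)..t, mlDensity a g s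
        ≤ ∫ s in (0:ℝ)..t, mlDensity a g s * (t - s) ^ (a - 1) := by
      rw [← intervalIntegral.integral_const_mul]
      apply intervalIntegral.integral_mono_on_of_le_Ioo ht.le ((ml_int a g t ha ht).const_mul _)
        (ml_conv_int a g t ha ht)
      intro s hs
      rw [mul_comm]
      have := (hp s hs.1).le
      gcongr ?_ * ?_
      exact Real.rpow_le_rpow_of_nonpos (by linarith [hs.2]) (by linarith [hs.1]) (by linarith)
    rw [ml_volterra a g t ha hg ht] at h1
    have h2 : 0 < Real.Gamma a / g * mlDensity a g t := by
      have := hp t ht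
      positivity
    have h3 : t ^ (a - 1) * ∫ s in (0:ℝ)..t, mlDensity a g s ≤ t ^ (a - 1) * 1 := by linarith
    exact le_of_mul_le_mul_left h3 hk

lemma ml_exp_integrable (a g : ℝ) (ha : 0 < a) (ha1 : a < 1) (hg : 0 < g) (l : ℝ) (hl : 0 ≤ l) :
    IntegrableOn (fun t : ℝ => Real.exp (-(l * t)) * mlDensity a g t) (Ioi 0) := by
  have h := ml_integrable a g ha ha1 hg
  refine Integrable.mono h (AEStronglyMeasurable.mul (by fun_prop) h.aestronglyMeasurable) ?_
  filter_upwards [ae_restrict_mem measurableSet_Ioi] with t ht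
  rw [norm_mul, Real.norm_of_nonneg (Real.exp_pos _).le]
  have htp : 0 < t := ht
  have : Real.exp (-(l * t)) ≤ 1 := Real.exp_le_one_iff.mpr (by nlinarith)
  exact mul_le_of_le_one_left (norm_nonneg _) this

lemma ml_laplace_pos (a g : ℝ) (ha : 0 < a) (ha1 : a < 1) (hg : 0 < g) (l : ℝ) (hl : 0 < l) :
    ∫ t in Ioi (0:ℝ), Real.exp (-(l * t)) * mlDensity a g t = g / (g + l ^ a) := by
  have hGa : 0 < Real.Gamma a := Real.Gamma_pos_of_pos ha
  have hla : 0 < l ^ a := Real.rpow_pos_of_pos hl _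
  have hf := ml_exp_integrable a g ha ha1 hg l hl.le
  have hkv := Real.integral_rpow_mul_exp_neg_mul_Ioi ha hl
  have hk : IntegrableOn (fun t : ℝ => t ^ (a - 1) * Real.exp (-(l * t))) (Ioi 0) := by
    by_contra hn
    rw [integral_undef hn] at hkv
    have : 0 < (1 / l) ^ a * Real.Gamma a := by positivity
    linarith
  have hc := integral_posConvolution hf hk (ContinuousLinearMap.mul ℝ ℝ)
  simp only [ContinuousLinearMap.mul_apply'] at hc
  rw [hkv] at hc
  set I := ∫ t in Ioi (0:ℝ), Real.exp (-(l * t)) * mlDensity a g t with hI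
  have e : ∫ x in Ioi (0:ℝ), ∫ t in (0:ℝ)..x, Real.exp (-(l * t)) * mlDensity a g t *
      ((x - t) ^ (a - 1) * Real.exp (-(l * (x - t))))
      = ∫ x in Ioi (0:ℝ), (x ^ (a - 1) * Real.exp (-(l * x))
          - Real.Gamma a / g * (Real.exp (-(l * x)) * mlDensity a g x)) := by
    apply setIntegral_congr_fun measurableSet_Ioi
    intro x hx
    have h1 : ∀ t, Real.exp (-(l * t)) * mlDensity a g t *
      ((x - t) ^ (a - 1) * Real.exp (-(l * (x - t)))) =
        Real.exp (-(l * x)) * (mlDensity a g t * (x - t) ^ (a - 1)) := fun t => by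
      have : Real.exp (-(l * x)) = Real.exp (-(l * t)) * Real.exp (-(l * (x - t))) := by
        rw [← Real.exp_add]; congr 1; ring
      rw [this]; ring
    simp only [h1]
    rw [intervalIntegral.integral_const_mul, ml_volterra a g x ha hg hx]
    ring
  rw [e, integral_sub hk (hf.const_mul _), hkv, integral_const_mul, ← hI, one_div,
    Real.inv_rpow hl.le] at hc
  field_simp at hc ⊢
  linarith

theorem laplace_transform_of_mlDensity
    (α γ : ℝ) (hα : α ∈ Set.Ioo (0:ℝ) 1) (hγ : 0 < γ) :
    ∀ l : ℝ, 0 ≤ l →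
      IntegrableOn (fun t : ℝ => Real.exp (-(l * t)) * mlDensity α γ t) (Set.Ioi 0) ∧
      (∫ t in Set.Ioi (0:ℝ),
          Real.exp (-(l * t)) * (γ * t ^ (α - 1) * mittagLeffler α α (-γ * t ^ α))) =
        γ / (γ + l ^ α) := by
  intro l hl
  obtain ⟨ha, ha1⟩ := hα
  refine ⟨ml_exp_integrable α γ ha ha1 hγ l hl, ?_⟩
  change ∫ t in Set.Ioi (0:ℝ), Real.exp (-(l * t)) * mlDensity α γ t = _
  rcases hl.lt_or_eq with h | h
  · exact ml_laplace_pos α γ ha ha1 hγ l h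
  subst h
  have hi := ml_integrable α γ ha ha1 hγ
  have h1 : Tendsto (fun l : ℝ => ∫ t in Set.Ioi (0:ℝ), Real.exp (-(l * t)) * mlDensity α γ t)
      (nhdsWithin 0 (Ioi 0))
      (nhds (∫ t in Set.Ioi (0:ℝ), Real.exp (-(0 * t)) * mlDensity α γ t)) := by
    apply tendsto_integral_filter_of_dominated_convergence (fun t => ‖mlDensity α γ t‖)
    · filter_upwards [self_mem_nhdsWithin] with l hl
      exact (ml_exp_integrable α γ ha ha1 hγ l (le_of_lt hl)).aestronglyMeasurable
    · filter_upwards [self_mem_nhdsWithin] with l hl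
      filter_upwards [ae_restrict_mem measurableSet_Ioi] with t ht
      rw [norm_mul, Real.norm_of_nonneg (Real.exp_pos _).le]
      have htp : 0 < t := ht
      have hlp : 0 < l := hl
      have : Real.exp (-(l * t)) ≤ 1 := Real.exp_le_one_iff.mpr (by nlinarith)
      exact mul_le_of_le_one_left (norm_nonneg _) this
    · exact hi.norm
    · refine Eventually.of_forall fun t => ?_
      have : Continuous fun l : ℝ => Real.exp (-(l * t)) * mlDensity α γ t := by fun_prop
      exact (this.tendsto 0).mono_left nhdsWithin_le_nhds
  have h2 : Tendsto (fun l : ℝ => γ / (γ + l ^ α)) (nhdsWithin 0 (Ioi 0))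
      (nhds (γ / (γ + 0 ^ α))) := by
    have hr := (Real.continuous_rpow_const ha.le).tendsto (0:ℝ)
    refine (Tendsto.div tendsto_const_nhds (tendsto_const_nhds.add hr) ?_).mono_left
      nhdsWithin_le_nhds
    rw [Real.zero_rpow ha.ne']; linarith
  refine tendsto_nhds_unique h1 (h2.congr' ?_)
  filter_upwards [self_mem_nhdsWithin] with l hl
  exact (ml_laplace_pos α γ ha ha1 hγ l hl).symm
end
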